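/- Let α be irrational, and let f : ℝ → ℝ be a 1-periodic function that is non-decreasing on [0,1) and satisfies ∫₀¹ log(1+|f(x)|) dx < ∞. Then for Lebesgue-almost every x ∈ [0,1), no real number E with 0 < L(E) < β(α) is an eigenvalue of the operator H(x); that is, there is no nonzero ℓ²(ℤ) solution ψ of ψ(n+1) + ψ(n−1) + f(x+nα)ψ(n) = Eψ(n). -/

import Mathlib

open MeasureTheory Filter
open scoped ENNReal NNReal

noncomputable section

attribute [local instance] Matrix.linftyOpNormedRing

/-- Iterates of the Gauss map, starting from the fractional part of `α`. -/
def gaussIter (α : ℝ) : ℕ → ℝ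
  | 0 => Int.fract α
  | (k+1) => Int.fract (gaussIter α k)⁻¹

/-- The continued fraction digit `a_{k+1}` of `α`. -/
def cfA (α : ℝ) (k : ℕ) : ℕ := ⌊(gaussIter α k)⁻¹⌋₊

/-- The denominators `q_k` of the continued fraction approximants of `α`:
`q₀ = 1`, `q₁ = a₁`, `q_{k+1} = a_{k+1} q_k + q_{k-1}`. -/
def cfDen (α : ℝ) : ℕ → ℕ
  | 0 => 1
  | 1 => cfA α 0
  | (k+2) => cfA α (k+1) * cfDen α (k+1) + cfDen α k

/-- The exponential rate of approximation `β(α) = limsup_k (log q_{k+1})/q_k ∈ [0,∞]`. -/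
def cfBeta (α : ℝ) : EReal :=
  Filter.limsup (fun k : ℕ => ((Real.log (cfDen α (k+1)) / (cfDen α k) : ℝ) : EReal))
    Filter.atTop

/-- The `n`-step transfer matrix `S_n^{f,E}(x) = S^{f,E}(x+(n-1)α) ⋯ S^{f,E}(x)` of the
quasiperiodic Schrödinger cocycle, where `S^{f,E}(y) = [[E - f y, -1], [1, 0]]`. -/
def schCocycle (α : ℝ) (f : ℝ → ℝ) (E : ℝ) (n : ℕ) (x : ℝ) :
    Matrix (Fin 2) (Fin 2) ℂ :=
  ((List.range n).map fun k =>
    !![((E : ℂ) - (f (x + ((n - 1 - k : ℕ) : ℝ) * α) : ℂ)), -1; 1, 0]).prod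


/-! ### Continued fractions -/

lemma gaussIter_irr {α : ℝ} (hα : Irrational α) (k : ℕ) : Irrational (gaussIter α k) := by
  have hfr : ∀ y : ℝ, Irrational y → Irrational (Int.fract y) := by
    intro y hy
    rw [Int.fract]
    exact hy.sub_intCast _
  induction k with
  | zero => exact hfr _ hα
  | succ k ih => exact hfr _ ih.inv

lemma gaussIter_pos {α : ℝ} (hα : Irrational α) (k : ℕ) : 0 < gaussIter α k := by
  have h0 : 0 ≤ gaussIter α k := by cases k <;> exact Int.fract_nonneg _
  exact lt_of_le_of_ne h0 (Ne.symm (gaussIter_irr hα k).ne_zero)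

lemma gaussIter_lt_one (α : ℝ) (k : ℕ) : gaussIter α k < 1 := by
  cases k <;> exact Int.fract_lt_one _

lemma gaussIter_succ {α : ℝ} (hα : Irrational α) (k : ℕ) :
    gaussIter α k * gaussIter α (k+1) = 1 - cfA α k * gaussIter α k := by
  have hp := gaussIter_pos hα k
  have h1 : gaussIter α (k+1) = (gaussIter α k)⁻¹ - cfA α k := by
    rw [gaussIter, Int.fract, cfA, natCast_floor_eq_intCast_floor (inv_nonneg.2 hp.le)]
  rw [h1]
  field_simp

lemma one_le_cfA {α : ℝ} (hα : Irrational α) (k : ℕ) : 1 ≤ cfA α k := by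
  apply Nat.le_floor
  rw [Nat.cast_one]
  exact (one_le_inv₀ (gaussIter_pos hα k)).2 (gaussIter_lt_one α k).le

lemma cfDen_pos {α : ℝ} (hα : Irrational α) (k : ℕ) : 1 ≤ cfDen α k ∧ 1 ≤ cfDen α (k+1) := by
  induction k with
  | zero => exact ⟨le_refl 1, one_le_cfA hα 0⟩
  | succ k ih =>
    refine ⟨ih.2, ?_⟩
    rw [cfDen]
    have := ih.1
    omega

lemma cfDen_ge {α : ℝ} (hα : Irrational α) (k : ℕ) : k ≤ cfDen α k := by
  induction k with
  | zero => exact Nat.zero_le _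
  | succ k ih =>
    cases k with
    | zero => exact (cfDen_pos hα 0).2
    | succ k =>
      rw [cfDen]
      have h1 := (cfDen_pos hα k).1
      have h2 := Nat.mul_le_mul_right (cfDen α (k+1)) (one_le_cfA hα (k+1))
      omega

/-- product of the Gauss iterates -/
def cfD (α : ℝ) : ℕ → ℝ
  | 0 => gaussIter α 0
  | (k+1) => cfD α k * gaussIter α (k+1)

lemma cfD_pos {α : ℝ} (hα : Irrational α) (k : ℕ) : 0 < cfD α k := by
  induction k with
  | zero => exact gaussIter_pos hα 0
  | succ k ih => exact mul_pos ih (gaussIter_pos hα _)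

lemma cfD_rec {α : ℝ} (hα : Irrational α) (k : ℕ) :
    cfD α (k+2) = cfD α k - cfA α (k+1) * cfD α (k+1) := by
  have h := gaussIter_succ hα (k+1)
  simp only [cfD]
  linear_combination cfD α k * h

lemma cfD_one {α : ℝ} (hα : Irrational α) : cfD α 1 = 1 - cfA α 0 * gaussIter α 0 := by
  simp only [cfD]
  exact gaussIter_succ hα 0

lemma cfD_det {α : ℝ} (hα : Irrational α) (k : ℕ) :
    cfDen α (k+1) * cfD α k + cfDen α k * cfD α (k+1) = 1 := by
  induction k with
  | zero =>
    rw [zero_add, cfD_one hα]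
    simp only [cfDen, cfD]
    push_cast
    ring
  | succ k ih =>
    rw [cfD_rec hα k]
    simp only [cfDen]
    push_cast
    linear_combination ih

lemma cfD_int {α : ℝ} (hα : Irrational α) (k : ℕ) :
    (∃ p : ℤ, cfDen α k * α - p = (-1)^k * cfD α k) ∧
    (∃ p : ℤ, cfDen α (k+1) * α - p = (-1)^(k+1) * cfD α (k+1)) := by
  induction k with
  | zero =>
    refine ⟨⟨⌊α⌋, ?_⟩, ⟨cfA α 0 * ⌊α⌋ + 1, ?_⟩⟩
    · simp only [cfDen, cfD, gaussIter, Int.fract]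
      push_cast
      ring
    · rw [zero_add, cfD_one hα]
      simp only [cfDen, gaussIter, Int.fract]
      push_cast
      ring
  | succ k ih =>
    obtain ⟨⟨p1, h1⟩, ⟨p2, h2⟩⟩ := ih
    refine ⟨⟨p2, h2⟩, ⟨cfA α (k+1) * p2 + p1, ?_⟩⟩
    rw [cfD_rec hα k]
    simp only [cfDen]
    push_cast
    rw [pow_succ] at h2
    rw [pow_succ, pow_succ]
    linear_combination h1 + cfA α (k+1) * h2

lemma cf_frequently {α : ℝ} (hα : Irrational α) (b : ℝ) (hb : (b : EReal) < cfBeta α) :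
    ∃ᶠ q : ℕ in atTop, ∃ p : ℤ, |q * α - p| ≤ Real.exp (-(b * q)) := by
  have ht : Tendsto (cfDen α) atTop atTop := tendsto_atTop_mono (cfDen_ge hα) tendsto_id
  apply ht.frequently
  have hfr := frequently_lt_of_lt_limsup (by isBoundedDefault) hb
  refine hfr.mono fun k hk => ?_
  obtain ⟨⟨p, hp⟩, -⟩ := cfD_int hα k
  refine ⟨p, ?_⟩
  have hk' : b < Real.log (cfDen α (k+1)) / (cfDen α k) := by exact_mod_cast hk
  have hq : (0:ℝ) < cfDen α k := by exact_mod_cast (cfDen_pos hα k).1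
  have hq1 : (0:ℝ) < cfDen α (k+1) := by exact_mod_cast (cfDen_pos hα k).2
  rw [lt_div_iff₀ hq] at hk'
  have h2 : Real.exp (b * cfDen α k) < cfDen α (k+1) := (Real.lt_log_iff_exp_lt hq1).1 hk'
  have hD := cfD_pos hα k
  have hD1 := cfD_pos hα (k+1)
  have hdet := cfD_det hα k
  rw [hp, abs_mul, abs_pow, abs_neg, abs_one, one_pow, one_mul, abs_of_pos hD, Real.exp_neg,
    le_inv_comm₀ hD (Real.exp_pos _), ← one_div, le_div_iff₀ hD]
  nlinarith [mul_pos hq hD1, mul_pos hD hq1, Real.exp_pos (b * cfDen α k)]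

/-! ### Uniform equidistribution for continuous functions on the circle -/

/-- uniform Birkhoff averages property -/
def UnifErg (a : UnitAddCircle) (g : C(UnitAddCircle, ℂ)) : Prop :=
  ∀ ε : ℝ, 0 < ε → ∀ᶠ n : ℕ in atTop, ∀ x : UnitAddCircle,
    ‖∑ i ∈ Finset.range n, g (x + i • a) - n * ∫ y, g y‖ ≤ ε * n

lemma circle_integrable (g : C(UnitAddCircle, ℂ)) : Integrable (fun y => g y) :=
  g.continuous.integrable_of_hasCompactSupport (HasCompactSupport.of_compactSpace _)

lemma unifErg_zero (a : UnitAddCircle) : UnifErg a 0 := by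
  intro ε hε
  refine Eventually.of_forall fun n x => ?_
  simp
  positivity

lemma unifErg_add (a : UnitAddCircle) {g h : C(UnitAddCircle, ℂ)} (hg : UnifErg a g)
    (hh : UnifErg a h) : UnifErg a (g + h) := by
  intro ε hε
  filter_upwards [hg (ε/2) (by positivity), hh (ε/2) (by positivity)] with n h1 h2 x
  have e : ∑ i ∈ Finset.range n, (g + h) (x + i • a) - n * ∫ y, (g + h) y =
      (∑ i ∈ Finset.range n, g (x + i • a) - n * ∫ y, g y) +
      (∑ i ∈ Finset.range n, h (x + i • a) - n * ∫ y, h y) := by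
    simp only [ContinuousMap.add_apply]
    rw [integral_add (circle_integrable g) (circle_integrable h), Finset.sum_add_distrib]
    ring
  rw [e]
  refine (norm_add_le _ _).trans ?_
  linarith [h1 x, h2 x]

lemma unifErg_smul (a : UnitAddCircle) (c : ℂ) {g : C(UnitAddCircle, ℂ)} (hg : UnifErg a g) :
    UnifErg a (c • g) := by
  intro ε hε
  filter_upwards [hg (ε / (‖c‖ + 1)) (by positivity)] with n h1 x
  have e : ∑ i ∈ Finset.range n, (c • g) (x + i • a) - n * ∫ y, (c • g) y =
      c * (∑ i ∈ Finset.range n, g (x + i • a) - n * ∫ y, g y) := by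
    simp only [ContinuousMap.smul_apply, smul_eq_mul]
    rw [integral_const_mul, ← Finset.mul_sum]
    ring
  rw [e, norm_mul]
  calc ‖c‖ * _ ≤ (‖c‖ + 1) * (ε / (‖c‖ + 1) * n) := by
        apply mul_le_mul _ (h1 x) (norm_nonneg _) (by positivity)
        linarith
    _ = ε * n := by field_simp

lemma unifErg_fourier {α : ℝ} (hα : Irrational α) (m : ℤ) :
    UnifErg (α : UnitAddCircle) (fourier m) := by
  rcases eq_or_ne m 0 with rfl | hm
  · intro ε hε
    refine Eventually.of_forall fun n x => ?_
    have hr : ∫ y : UnitAddCircle, (fourier 0 y : ℂ) = 1 := by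
      simp only [fourier_zero]
      simp [Measure.real]
    rw [hr]
    simp only [fourier_zero, Finset.sum_const, Finset.card_range, nsmul_eq_mul, sub_self,
      norm_zero]
    positivity
  set z : ℂ := fourier m (α : UnitAddCircle) with hz
  have hadd : ∀ x y : UnitAddCircle, (fourier m (x + y) : ℂ) = fourier m x * fourier m y := by
    intro x y
    simp [fourier_apply, AddCircle.toCircle_add, smul_add]
  have hz1 : z ≠ 1 := by
    intro h
    rw [hz, fourier_coe_apply, Complex.exp_eq_one_iff] at h
    obtain ⟨n, hn⟩ := h
    have hpi : (2 * Real.pi * Complex.I : ℂ) ≠ 0 := by simp [Real.pi_ne_zero]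
    have h2 : ((m * α : ℝ) : ℂ) = ((n : ℝ) : ℂ) := by
      push_cast
      apply mul_left_cancel₀ hpi
      rw [← sub_eq_zero]
      rw [← sub_eq_zero] at hn
      rw [← hn]
      push_cast
      ring
    have h3 : (m * α : ℝ) = (n : ℝ) := by exact_mod_cast h2
    exact (hα.intCast_mul hm).ne_int n h3
  have hzn : ‖z‖ = 1 := Circle.norm_coe _
  have hintg : ∫ y : UnitAddCircle, (fourier m y : ℂ) = 0 := by
    have h1 : ∫ y : UnitAddCircle, (fourier m (y + (α : UnitAddCircle)) : ℂ)
        = ∫ y : UnitAddCircle, (fourier m y : ℂ) :=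
      integral_add_right_eq_self (fun y : UnitAddCircle => (fourier m y : ℂ)) _
    simp_rw [hadd] at h1
    rw [integral_mul_const] at h1
    have h2 : (∫ y : UnitAddCircle, (fourier m y : ℂ)) * (z - 1) = 0 := by
      rw [mul_sub, h1]; ring
    exact (mul_eq_zero.1 h2).resolve_right (sub_ne_zero.2 hz1)
  have hpow : ∀ (i : ℕ) (x : UnitAddCircle),
      (fourier m (x + i • (α : UnitAddCircle)) : ℂ) = fourier m x * z ^ i := by
    intro i x
    induction i with
    | zero => simp
    | succ i ih => rw [succ_nsmul, ← add_assoc, hadd, ih, pow_succ]; ring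
  intro ε hε
  have hzp : 0 < ‖z - 1‖ := norm_pos_iff.2 (sub_ne_zero.2 hz1)
  filter_upwards [eventually_ge_atTop (⌈2 / ‖z - 1‖ / ε⌉₊)] with n hn x
  have hn' := Nat.ceil_le.1 hn
  rw [hintg, mul_zero, sub_zero]
  simp_rw [hpow]
  rw [← Finset.mul_sum, geom_sum_eq hz1, norm_mul, norm_div]
  have h1 : ‖(fourier m x : ℂ)‖ = 1 := Circle.norm_coe _
  have h2 : ‖z ^ n - 1‖ ≤ 2 := by
    refine (norm_sub_le _ _).trans ?_
    rw [norm_pow, hzn]; norm_num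
  rw [h1, one_mul]
  calc _ ≤ 2 / ‖z - 1‖ := by gcongr
    _ ≤ ε * n := by rw [div_le_iff₀ hε] at hn'; linarith

lemma unifErg_all {α : ℝ} (hα : Irrational α) (g : C(UnitAddCircle, ℂ)) :
    UnifErg (α : UnitAddCircle) g := by
  have hspan : ∀ h ∈ Submodule.span ℂ (Set.range (@fourier 1)),
      UnifErg (α : UnitAddCircle) h := by
    intro h hh
    induction hh using Submodule.span_induction with
    | mem x hx => obtain ⟨m, rfl⟩ := hx; exact unifErg_fourier hα m
    | zero => exact unifErg_zero _
    | add x y _ _ hx hy => exact unifErg_add _ hx hy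
    | smul c x _ hx => exact unifErg_smul _ c hx
  have hcl : g ∈ (Submodule.span ℂ (Set.range (@fourier 1))).topologicalClosure := by
    have : Fact ((0:ℝ) < 1) := ⟨one_pos⟩
    rw [span_fourier_closure_eq_top]; trivial
  rw [← SetLike.mem_coe, Submodule.topologicalClosure_coe, Metric.mem_closure_iff] at hcl
  intro ε hε
  obtain ⟨h, hh, hd⟩ := hcl (ε / 3) (by positivity)
  rw [dist_eq_norm] at hd
  filter_upwards [hspan h hh (ε/3) (by positivity)] with n hn x
  have hpt : ∀ y, ‖g y - h y‖ ≤ ε / 3 := fun y => ((g - h).norm_coe_le_norm y).trans hd.le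
  have e : ∑ i ∈ Finset.range n, g (x + i • (α : UnitAddCircle)) - n * ∫ y, g y =
      (∑ i ∈ Finset.range n, h (x + i • (α : UnitAddCircle)) - n * ∫ y, h y) +
      ∑ i ∈ Finset.range n, (g (x + i • (α : UnitAddCircle)) - h (x + i • (α : UnitAddCircle)))
      - n * ∫ y, (g y - h y) := by
    rw [integral_sub (circle_integrable g) (circle_integrable h), Finset.sum_sub_distrib]
    ring
  have h1 : ‖∑ i ∈ Finset.range n,
      (g (x + i • (α : UnitAddCircle)) - h (x + i • (α : UnitAddCircle)))‖ ≤ n * (ε / 3) := by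
    refine (norm_sum_le_of_le _ (fun i _ => hpt _)).trans ?_
    simp
  have h2 : ‖∫ y : UnitAddCircle, (g y - h y)‖ ≤ ε / 3 := by
    have := norm_integral_le_of_norm_le_const (μ := (volume : Measure UnitAddCircle))
      (f := fun y => g y - h y) (Eventually.of_forall hpt)
    simpa [Measure.real] using this
  have h3 : ‖(n : ℂ) * ∫ y : UnitAddCircle, (g y - h y)‖ ≤ n * (ε / 3) := by
    rw [norm_mul, Complex.norm_natCast]
    gcongr
  rw [e]
  refine (norm_sub_le _ _).trans ?_
  have := norm_add_le (∑ i ∈ Finset.range n, h (x + i • (α : UnitAddCircle)) - n * ∫ y, h y)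
    (∑ i ∈ Finset.range n, (g (x + i • (α : UnitAddCircle)) - h (x + i • (α : UnitAddCircle))))
  linarith [hn x]

lemma unifErg_real {α : ℝ} (hα : Irrational α) (g : UnitAddCircle → ℝ) (hg : Continuous g)
    (ε : ℝ) (hε : 0 < ε) : ∀ᶠ n : ℕ in atTop, ∀ x : UnitAddCircle,
    |∑ i ∈ Finset.range n, g (x + i • (α : UnitAddCircle)) - n * ∫ y, g y| ≤ ε * n := by
  have h := unifErg_all hα ⟨fun y => (g y : ℂ), Complex.continuous_ofReal.comp hg⟩ ε hε
  filter_upwards [h] with n hn x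
  have h1 := hn x
  simp only [ContinuousMap.coe_mk] at h1
  rw [integral_complex_ofReal] at h1
  rw [← Real.norm_eq_abs, ← Complex.norm_real]
  push_cast
  exact h1

/-! ### Measure lemmas for periodic functions -/

/-- Lebesgue measure on the unit interval -/
def unu : Measure ℝ := volume.restrict (Set.Ico (0:ℝ) 1)

lemma unu_eq : unu = volume.restrict (Set.Ioc (0:ℝ) (0 + 1)) := by
  rw [unu, zero_add]
  exact Measure.restrict_congr_set Ico_ae_eq_Ioc

instance : IsProbabilityMeasure unu := ⟨by simp [unu]⟩

lemma unu_lintegral_circle (w : UnitAddCircle → ℝ≥0∞) :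
    ∫⁻ x, w (x : UnitAddCircle) ∂unu = ∫⁻ y, w y := by
  rw [unu_eq]
  exact UnitAddCircle.lintegral_preimage 0 w

lemma unu_integral_circle (w : UnitAddCircle → ℝ) :
    ∫ x, w (x : UnitAddCircle) ∂unu = ∫ y, w y := by
  rw [unu_eq]
  exact UnitAddCircle.integral_preimage 0 w

lemma unu_mp : MeasurePreserving ((↑) : ℝ → UnitAddCircle) unu volume := by
  rw [unu_eq]
  exact UnitAddCircle.measurePreserving_mk 0

lemma per_lintegral {w : ℝ → ℝ≥0∞} (hw : Function.Periodic w 1) (a : ℝ) :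
    ∫⁻ x, w (x + a) ∂unu = ∫⁻ x, w x ∂unu := by
  have h1 := unu_lintegral_circle (fun y => hw.lift (y + (a : UnitAddCircle)))
  have h2 := unu_lintegral_circle hw.lift
  rw [lintegral_add_right_eq_self (fun y => hw.lift y)] at h1
  simp only [← AddCircle.coe_add, Function.Periodic.lift_coe] at h1 h2
  rw [h1, h2]

lemma markov_sum {w : ℝ → ℝ≥0∞} (hw : Function.Periodic w 1) (hm : Measurable w) (n : ℕ)
    (a : ℕ → ℝ) (t : ℝ≥0∞) (ht0 : t ≠ 0) (ht : t ≠ ∞) :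
    unu {x | t ≤ ∑ i ∈ Finset.range n, w (x + a i)} ≤ n * (∫⁻ x, w x ∂unu) / t := by
  refine (meas_ge_le_lintegral_div ?_ ht0 ht).trans ?_
  · apply Measurable.aemeasurable
    fun_prop
  · rw [lintegral_finsetSum _ (fun i _ => by fun_prop)]
    simp_rw [per_lintegral hw]
    simp

lemma tail_small {h : ℝ → ℝ} (hp : Function.Periodic h 1) (hm : Measurable h)
    (hi : Integrable h unu) (α ε : ℝ) (hε : 0 < ε) (s : ℕ → ℝ) :
    Tendsto (fun q : ℕ => unu {x | ∃ j < 2 * q, ε * q < h (x + s q + j * α)}) atTop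
      (nhds 0) := by
  set w : ℕ → ℝ → ℝ≥0∞ := fun q => fun y => if ε * q < h y then ENNReal.ofReal (h y) else 0
    with hw
  have hwm : ∀ q, Measurable (w q) := fun q =>
    Measurable.ite (measurableSet_lt measurable_const hm) hm.ennreal_ofReal measurable_const
  have hwp : ∀ q, Function.Periodic (w q) 1 := by
    intro q y
    simp only [hw, hp y]
  have hlim : Tendsto (fun q => ∫⁻ x, w q x ∂unu) atTop (nhds 0) := by
    have := tendsto_lintegral_of_dominated_convergence (μ := unu) (F := w) (f := fun _ => 0)
      (fun y => ENNReal.ofReal (h y)) hwm ?_ ?_ ?_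
    · simpa using this
    · intro q
      refine Eventually.of_forall fun y => ?_
      simp only [hw]
      split_ifs <;> simp
    · exact hi.lintegral_lt_top.ne
    · refine Eventually.of_forall fun y => ?_
      apply tendsto_const_nhds.congr'
      filter_upwards [eventually_ge_atTop (⌈h y / ε⌉₊)] with q hq
      have h1 := Nat.ceil_le.1 hq
      rw [div_le_iff₀ hε] at h1
      simp only [hw]
      rw [if_neg]
      linarith
  have hlim2 : Tendsto (fun q => ENNReal.ofReal (2 / ε) * ∫⁻ x, w q x ∂unu) atTop (nhds 0) := by
    have := ENNReal.Tendsto.const_mul (a := ENNReal.ofReal (2 / ε)) hlim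
      (Or.inr ENNReal.ofReal_ne_top)
    simpa using this
  refine tendsto_of_tendsto_of_tendsto_of_le_of_le' tendsto_const_nhds hlim2
    (Eventually.of_forall fun _ => zero_le) ?_
  filter_upwards [eventually_gt_atTop 0] with q hq
  have hq' : (0:ℝ) < q := by exact_mod_cast hq
  have ht0 : ENNReal.ofReal (ε * q) ≠ 0 := by
    rw [Ne, ENNReal.ofReal_eq_zero, not_le]; positivity
  have hmk := markov_sum (hwp q) (hwm q) (2 * q) (fun j => s q + j * α) (ENNReal.ofReal (ε * q))
    ht0 ENNReal.ofReal_ne_top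
  refine (measure_mono ?_).trans (hmk.trans ?_)
  · rintro x ⟨j, hj, hx⟩
    simp only [Set.mem_ofPred_eq]
    rw [add_assoc] at hx
    refine le_trans ?_ (Finset.single_le_sum (f := fun i : ℕ => w q (x + (s q + i * α)))
      (fun i _ => zero_le) (Finset.mem_range.2 hj))
    simp only [hw]
    rw [if_pos hx]
    exact ENNReal.ofReal_le_ofReal hx.le
  · rw [mul_comm, mul_div_assoc, mul_comm]
    gcongr
    have e : ((2 * q : ℕ) : ℝ≥0∞) = ENNReal.ofReal (2 * q) := by
      rw [← ENNReal.ofReal_natCast]; push_cast; rfl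
    rw [e, ← ENNReal.ofReal_div_of_pos (by positivity)]
    apply ENNReal.ofReal_le_ofReal
    apply le_of_eq
    field_simp

lemma erg_small {h : ℝ → ℝ} (hp : Function.Periodic h 1) (hm : Measurable h)
    (hi : Integrable h unu) {α : ℝ} (hα : Irrational α) (c : ℝ) (hc : ∫ x, h x ∂unu < c)
    (s : ℕ → ℝ) (l : Filter ℕ) (hl : l ≤ atTop)
    (hl2 : Tendsto (fun q : ℕ => (((q * α : ℝ)) : UnitAddCircle)) l (nhds 0)) :
    Tendsto (fun q : ℕ => unu {x | c * q ≤ ∑ i ∈ Finset.range q,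
      max (h (x + s q + i * α)) (h (x + s q + q * α + i * α))}) l (nhds 0) := by
  rw [ENNReal.tendsto_nhds_zero]
  intro δ hδ
  rcases eq_or_ne δ ∞ with rfl | hδt
  · exact Eventually.of_forall fun _ => le_top
  set d := δ.toReal with hd
  have hdpos : 0 < d := ENNReal.toReal_pos hδ.ne' hδt
  set ε := (c - ∫ x, h x ∂unu) / 4 with hε
  have hεpos : 0 < ε := by rw [hε]; linarith
  set η := min ε (ε * d / 2) with hη
  have hηpos : 0 < η := by positivity
  have hH : Integrable hp.lift (volume : Measure UnitAddCircle) := by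
    have hlm : Measurable hp.lift := QuotientAddGroup.measurable_from_quotient.2 hm
    rw [← unu_mp.integrable_comp hlm.aestronglyMeasurable]
    exact hi
  obtain ⟨g, hg, hgi⟩ := hH.exists_boundedContinuous_integral_sub_le hηpos
  have hHint : ∫ y, hp.lift y = ∫ x, h x ∂unu := by
    rw [← unu_integral_circle]
    rfl
  have hgint : ∫ y, g y ≤ ∫ x, h x ∂unu + ε := by
    have h1 : (∫ y, g y) - ∫ y, hp.lift y ≤ η := by
      rw [← integral_sub hgi hH]
      refine le_trans (integral_mono (hgi.sub hH) (hH.sub hgi).norm fun y => ?_) hg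
      simp only [Pi.sub_apply, Real.norm_eq_abs]
      rw [abs_sub_comm]
      exact le_abs_self _
    rw [hHint] at h1
    linarith [min_le_left ε (ε * d / 2)]
  set w : ℝ → ℝ≥0∞ := fun y => ENNReal.ofReal |h y - g (y : UnitAddCircle)| with hw
  have hgm : Measurable fun y : ℝ => g (y : UnitAddCircle) :=
    (g.continuous.comp (AddCircle.continuous_mk' 1)).measurable
  have hwm : Measurable w := ((hm.sub hgm).abs).ennreal_ofReal
  have hgp : ∀ y : ℝ, g ((y + 1 : ℝ) : UnitAddCircle) = g (y : UnitAddCircle) := by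
    intro y
    rw [AddCircle.coe_add_period]
  have hwp : Function.Periodic w 1 := by
    intro y
    simp only [hw, hp y, hgp y]
  have hwint : ∫⁻ x, w x ∂unu ≤ ENNReal.ofReal η := by
    have h1 := unu_lintegral_circle (fun y => ENNReal.ofReal ‖hp.lift y - g y‖)
    rw [← ofReal_integral_eq_lintegral_ofReal (f := fun y => ‖hp.lift y - g y‖) (hH.sub hgi).norm
      (Eventually.of_forall fun _ => norm_nonneg _)] at h1
    refine le_trans (le_of_eq ?_) (h1.le.trans (ENNReal.ofReal_le_ofReal hg))
    rfl
  have hunif : ∀ᶠ q : ℕ in l, ∀ y : UnitAddCircle,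
      |g (y + ((q * α : ℝ) : UnitAddCircle)) - g y| ≤ ε := by
    have huc : UniformContinuous g :=
      CompactSpace.uniformContinuous_of_continuous g.continuous
    rw [Metric.uniformContinuous_iff] at huc
    obtain ⟨r, hr, hr2⟩ := huc ε hεpos
    filter_upwards [hl2 (Metric.ball_mem_nhds 0 hr)] with q hq y
    have h3 : dist (y + ((q * α : ℝ) : UnitAddCircle)) y < r := by
      simpa [dist_eq_norm] using hq
    exact (hr2 h3).le
  filter_upwards [hunif, hl (unifErg_real hα g g.continuous ε hεpos),
    hl (eventually_gt_atTop 0)] with q hq1 hq2 hq0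
  have hq' : (0:ℝ) < q := by exact_mod_cast hq0
  have ht0 : ENNReal.ofReal (ε * q) ≠ 0 := by
    rw [Ne, ENNReal.ofReal_eq_zero, not_le]; positivity
  have hw2p : Function.Periodic (fun y => w y + w (y + q * α)) 1 := by
    intro y
    have := hwp (y + q * α)
    simp only
    rw [hwp y, ← this]
    congr 2
    ring
  have hmk := markov_sum hw2p (by fun_prop) q (fun j => s q + j * α) (ENNReal.ofReal (ε * q))
    ht0 ENNReal.ofReal_ne_top
  rw [lintegral_add_left hwm, per_lintegral hwp] at hmk
  refine (measure_mono ?_).trans (hmk.trans ?_)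
  · intro x hx
    simp only [Set.mem_ofPred_eq] at hx ⊢
    have e1 : ∀ i : ℕ, w (x + (s q + i * α)) + w (x + (s q + i * α) + q * α) =
        ENNReal.ofReal (|h (x + (s q + i * α)) - g ((x + (s q + i * α) : ℝ) : UnitAddCircle)| +
          |h (x + (s q + i * α) + q * α)
            - g ((x + (s q + i * α) + q * α : ℝ) : UnitAddCircle)|) := by
      intro i
      rw [ENNReal.ofReal_add (abs_nonneg _) (abs_nonneg _)]
    simp_rw [e1]
    rw [← ENNReal.ofReal_sum_of_nonneg (fun i _ => by positivity)]
    apply ENNReal.ofReal_le_ofReal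
    have e2 : ∀ i ∈ Finset.range q,
        max (h (x + s q + i * α)) (h (x + s q + q * α + i * α)) ≤
        (|h (x + (s q + i * α)) - g ((x + (s q + i * α) : ℝ) : UnitAddCircle)| +
          |h (x + (s q + i * α) + q * α)
            - g ((x + (s q + i * α) + q * α : ℝ) : UnitAddCircle)|) +
        (g (((x + s q : ℝ) : UnitAddCircle) + i • (α : UnitAddCircle)) + ε) := by
      intro i _
      have c1 : x + (s q + i * α) = x + s q + i * α := by ring
      have c2 : x + (s q + i * α) + q * α = x + s q + q * α + i * α := by ring
      have c3 : ((x + s q : ℝ) : UnitAddCircle) + i • (α : UnitAddCircle) =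
          ((x + s q + i * α : ℝ) : UnitAddCircle) := by
        rw [← AddCircle.coe_nsmul, ← AddCircle.coe_add, nsmul_eq_mul]
      have c4 := hq1 ((x + s q + i * α : ℝ) : UnitAddCircle)
      rw [← AddCircle.coe_add, ← c1, c2, c1] at c4
      rw [c2, c1, c3]
      have a1 := le_abs_self (h (x + s q + i * α) - g ((x + s q + i * α : ℝ) : UnitAddCircle))
      have a2 := le_abs_self (h (x + s q + q * α + i * α)
        - g ((x + s q + q * α + i * α : ℝ) : UnitAddCircle))
      have a3 := abs_nonneg (h (x + s q + i * α) - g ((x + s q + i * α : ℝ) : UnitAddCircle))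
      have a4 := abs_nonneg (h (x + s q + q * α + i * α)
        - g ((x + s q + q * α + i * α : ℝ) : UnitAddCircle))
      have a5 := abs_le.1 c4
      apply max_le <;> linarith [a5.1, a5.2]
    have e3 := Finset.sum_le_sum e2
    rw [Finset.sum_add_distrib] at e3
    have e3' : ∑ i ∈ Finset.range q, (g (((x + s q : ℝ) : UnitAddCircle)
        + i • (α : UnitAddCircle)) + ε) = ∑ i ∈ Finset.range q, g (((x + s q : ℝ) : UnitAddCircle)
        + i • (α : UnitAddCircle)) + q * ε := by
      rw [Finset.sum_add_distrib, Finset.sum_const, Finset.card_range, nsmul_eq_mul]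
    rw [e3'] at e3
    have e4 := (abs_le.1 (hq2 ((x + s q : ℝ) : UnitAddCircle))).2
    have e5 : (q : ℝ) * ∫ y, g y ≤ q * (∫ x, h x ∂unu + ε) := by gcongr
    have e6 : c * q = q * (∫ x, h x ∂unu) + 4 * ε * q := by rw [hε]; ring
    nlinarith
  · have e7 : (q : ℝ≥0∞) * (∫⁻ x, w x ∂unu + ∫⁻ x, w x ∂unu) / ENNReal.ofReal (ε * q) ≤
        (ENNReal.ofReal q) * (ENNReal.ofReal η + ENNReal.ofReal η) / ENNReal.ofReal (ε * q) := by
      rw [ENNReal.ofReal_natCast]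
      gcongr
    refine e7.trans ?_
    rw [← ENNReal.ofReal_add hηpos.le hηpos.le, ← ENNReal.ofReal_mul hq'.le,
      ← ENNReal.ofReal_div_of_pos (by positivity), ← ENNReal.ofReal_toReal hδt, ← hd]
    apply ENNReal.ofReal_le_ofReal
    rw [div_le_iff₀ (by positivity)]
    nlinarith [min_le_right ε (ε * d / 2)]

/-! ### Small differences for monotone functions -/

lemma per_integral {w : ℝ → ℝ} (hw : Function.Periodic w 1) (a : ℝ) :
    ∫ x, w (x + a) ∂unu = ∫ x, w x ∂unu := by
  have h1 := unu_integral_circle (fun y => hw.lift (y + (a : UnitAddCircle)))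
  have h2 := unu_integral_circle hw.lift
  rw [integral_add_right_eq_self (fun y => hw.lift y)] at h1
  simp only [← AddCircle.coe_add, Function.Periodic.lift_coe] at h1 h2
  rw [h1, h2]

lemma mono_diff {u : ℝ → ℝ} (hp : Function.Periodic u 1) (hmono : MonotoneOn u (Set.Ico 0 1))
    (hm : Measurable u) (T : ℝ) (hT : ∀ x, |u x| ≤ T) (δ : ℝ) (hδ : 0 ≤ δ) :
    ∫⁻ x, ENNReal.ofReal |u (x + δ) - u x| ∂unu ≤ ENNReal.ofReal (4 * T * δ) := by
  have hT0 : 0 ≤ T := (abs_nonneg _).trans (hT 0)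
  have hu : Integrable u unu := Integrable.of_bound hm.aestronglyMeasurable T
    (Eventually.of_forall hT)
  have hud : Integrable (fun x => u (x + δ)) unu :=
    Integrable.of_bound (hm.comp (measurable_add_const δ)).aestronglyMeasurable T
      (Eventually.of_forall fun x => hT _)
  have hind : Integrable ((Set.Ici (1 - δ)).indicator fun _ => 4 * T) unu :=
    (integrable_const _).indicator measurableSet_Ici
  have hF : Integrable (fun x => |u (x + δ) - u x|) unu := (hud.sub hu).abs
  have hmain : ∫ x, |u (x + δ) - u x| ∂unu ≤ 4 * T * δ := by
    have h1 : ∫ x, |u (x + δ) - u x| ∂unu ≤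
        ∫ x, ((u (x + δ) - u x) + (Set.Ici (1 - δ)).indicator (fun _ => 4 * T) x) ∂unu := by
      refine integral_mono_ae hF ((hud.sub hu).add hind) ?_
      have hmem : ∀ᵐ x ∂unu, x ∈ Set.Ico (0:ℝ) 1 := ae_restrict_mem measurableSet_Ico
      filter_upwards [hmem] with x hx
      by_cases hx1 : 1 - δ ≤ x
      · rw [Set.indicator_of_mem (by exact hx1)]
        have a1 := abs_le.1 (hT x)
        have a2 := abs_le.1 (hT (x + δ))
        rw [abs_le]
        constructor <;> linarith [a1.1, a1.2, a2.1, a2.2]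
      · rw [Set.indicator_of_notMem (by exact hx1), add_zero]
        push Not at hx1
        have := hmono hx (show x + δ ∈ Set.Ico (0:ℝ) 1 from ⟨by linarith [hx.1], by linarith⟩)
          (by linarith)
        rw [abs_of_nonneg (by linarith)]
    refine h1.trans ?_
    have hus : Integrable (fun x => u (x + δ) - u x) unu := hud.sub hu
    rw [integral_add hus hind, integral_sub hud hu, per_integral hp, sub_self, zero_add,
      integral_indicator_const _ measurableSet_Ici, smul_eq_mul]
    have h2 : unu.real (Set.Ici (1 - δ)) ≤ δ := by
      rw [Measure.real]
      apply ENNReal.toReal_le_of_le_ofReal hδ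
      rw [unu, Measure.restrict_apply measurableSet_Ici]
      have h3 : Set.Ici (1 - δ) ∩ Set.Ico 0 1 ⊆ Set.Icc (1 - δ) 1 :=
        fun x hx => ⟨hx.1, hx.2.2.le⟩
      refine (measure_mono h3).trans ?_
      rw [Real.volume_Icc]
      apply le_of_eq
      congr 1
      ring
    nlinarith
  rw [← ofReal_integral_eq_lintegral_ofReal hF (Eventually.of_forall fun _ => abs_nonneg _)]
  exact ENNReal.ofReal_le_ofReal hmain

lemma mono_diff' {u : ℝ → ℝ} (hp : Function.Periodic u 1) (hmono : MonotoneOn u (Set.Ico 0 1))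
    (hm : Measurable u) (T : ℝ) (hT : ∀ x, |u x| ≤ T) (a : ℝ) (p : ℤ) (d : ℝ)
    (hd : |a - p| ≤ d) :
    ∫⁻ x, ENNReal.ofReal |u (x + a) - u x| ∂unu ≤ ENNReal.ofReal (4 * T * d) := by
  have hT0 : 0 ≤ T := (abs_nonneg _).trans (hT 0)
  have h1 : ∀ x, u (x + a) = u (x + (a - p)) := by
    intro x
    have := hp.sub_zsmul_eq (x := x + a) p
    rw [← this]
    congr 1
    simp
    ring
  simp_rw [h1]
  rcases le_total 0 (a - p) with h | h
  · rw [abs_of_nonneg h] at hd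
    refine (mono_diff hp hmono hm T hT _ h).trans (ENNReal.ofReal_le_ofReal ?_)
    gcongr
  · rw [abs_of_nonpos h] at hd
    have hper : Function.Periodic (fun x => ENNReal.ofReal |u (x + (a - p)) - u x|) 1 := by
      intro x
      simp only
      rw [hp x, add_right_comm, hp]
    rw [← per_lintegral hper (-(a - p))]
    simp only [neg_add_cancel_right]
    simp_rw [abs_sub_comm (u _) (u (_ + -(a - p)))]
    refine (mono_diff hp hmono hm T hT _ (by linarith)).trans (ENNReal.ofReal_le_ofReal ?_)
    gcongr

lemma exp_small (ε : ℝ) (hε : 0 < ε) (C : ℝ) :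
    Tendsto (fun q : ℕ => C * (q * Real.exp (-(ε * q)))) atTop (nhds 0) := by
  have h := (Real.tendsto_pow_mul_exp_neg_atTop_nhds_zero 1).comp
    (tendsto_natCast_atTop_atTop.const_mul_atTop hε)
  have h2 := h.const_mul (C / ε)
  rw [mul_zero] at h2
  refine h2.congr fun q => ?_
  simp only [Function.comp_apply, pow_one]
  field_simp

lemma diff_small {f : ℝ → ℝ} (hp : Function.Periodic f 1) (hmono : MonotoneOn f (Set.Ico 0 1))
    (hm : Measurable f) (α b ε ε' : ℝ) (hε : ε' < ε) (s : ℕ → ℝ) (l : Filter ℕ)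
    (hl : l ≤ atTop) (hl3 : ∀ᶠ q : ℕ in l, ∃ p : ℤ, |q * α - p| ≤ Real.exp (-(b * q))) :
    Tendsto (fun q : ℕ => unu {x | ∃ j < q,
      Real.exp (-((b - ε) * q)) < |f (x + s q + j * α + q * α) - f (x + s q + j * α)| ∧
      |f (x + s q + j * α)| ≤ Real.exp (ε' * q) ∧
      |f (x + s q + j * α + q * α)| ≤ Real.exp (ε' * q)}) l (nhds 0) := by
  have hlim : Tendsto (fun q : ℕ => ENNReal.ofReal (4 * (q * Real.exp (-((ε - ε') * q))))) l
      (nhds 0) := by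
    have := ENNReal.tendsto_ofReal ((exp_small (ε - ε') (by linarith) 4).mono_left hl)
    simpa using this
  refine tendsto_of_tendsto_of_tendsto_of_le_of_le' tendsto_const_nhds hlim
    (Eventually.of_forall fun _ => zero_le) ?_
  filter_upwards [hl3] with q hq
  obtain ⟨p, hpq⟩ := hq
  set T := Real.exp (ε' * q) with hTd
  have hTpos : 0 < T := Real.exp_pos _
  set u : ℝ → ℝ := fun x => max (-T) (min T (f x)) with hu
  have hup : Function.Periodic u 1 := by
    intro x
    simp only [hu, hp x]
  have hum : Measurable u := by fun_prop
  have humono : MonotoneOn u (Set.Ico 0 1) := by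
    intro x hx y hy hxy
    have := hmono hx hy hxy
    simp only [hu]
    gcongr
  have huT : ∀ x, |u x| ≤ T := by
    intro x
    rw [abs_le]
    exact ⟨le_max_left _ _, max_le (by linarith) (min_le_left _ _)⟩
  have hueq : ∀ x, |f x| ≤ T → u x = f x := by
    intro x hx
    have h := abs_le.1 hx
    simp only [hu]
    rw [min_eq_right h.2, max_eq_right h.1]
  have hintg := mono_diff' hup humono hum T huT (q * α) p _ hpq
  have hwp : Function.Periodic (fun x => ENNReal.ofReal |u (x + q * α) - u x|) 1 := by
    intro x
    simp only
    rw [hup x, add_right_comm, hup]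
  have ht0 : ENNReal.ofReal (Real.exp (-((b - ε) * q))) ≠ 0 := by
    rw [Ne, ENNReal.ofReal_eq_zero, not_le]; positivity
  have hmk := markov_sum hwp (by fun_prop) q (fun j => s q + j * α)
    (ENNReal.ofReal (Real.exp (-((b - ε) * q)))) ht0 ENNReal.ofReal_ne_top
  refine (measure_mono ?_).trans (hmk.trans ?_)
  · rintro x ⟨j, hj, hx1, hx2, hx3⟩
    simp only [Set.mem_ofPred_eq]
    refine le_trans ?_ (Finset.single_le_sum
      (f := fun i : ℕ => ENNReal.ofReal |u (x + (s q + i * α) + q * α) - u (x + (s q + i * α))|)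
      (fun i _ => zero_le) (Finset.mem_range.2 hj))
    rw [← add_assoc, hueq _ hx2, hueq _ hx3]
    exact ENNReal.ofReal_le_ofReal hx1.le
  · have e7 : (q : ℝ≥0∞) * (∫⁻ x, ENNReal.ofReal |u (x + q * α) - u x| ∂unu) /
        ENNReal.ofReal (Real.exp (-((b - ε) * q))) ≤
        (ENNReal.ofReal q) * (ENNReal.ofReal (4 * T * Real.exp (-(b * q)))) /
        ENNReal.ofReal (Real.exp (-((b - ε) * q))) := by
      rw [ENNReal.ofReal_natCast]
      gcongr
    refine e7.trans ?_
    rw [← ENNReal.ofReal_mul (Nat.cast_nonneg q),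
      ← ENNReal.ofReal_div_of_pos (by positivity)]
    apply ENNReal.ofReal_le_ofReal
    rw [div_le_iff₀ (by positivity)]
    apply le_of_eq
    have : T * Real.exp (-(b * q)) =
        Real.exp (-((ε - ε') * q)) * Real.exp (-((b - ε) * q)) := by
      rw [hTd, ← Real.exp_add, ← Real.exp_add]
      congr 1
      ring
    linear_combination 4 * q * this

/-! ### Cocycle algebra -/

/-- one step matrix -/
def stepM (E v : ℝ) : Matrix (Fin 2) (Fin 2) ℂ := !![((E : ℂ) - (v : ℂ)), -1; 1, 0]

lemma coc_zero (α : ℝ) (f : ℝ → ℝ) (E x : ℝ) : schCocycle α f E 0 x = 1 := by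
  simp [schCocycle]

lemma coc_succ (α : ℝ) (f : ℝ → ℝ) (E : ℝ) (n : ℕ) (x : ℝ) :
    schCocycle α f E (n+1) x = stepM E (f (x + n * α)) * schCocycle α f E n x := by
  unfold schCocycle
  rw [List.range_succ_eq_map, List.map_cons, List.prod_cons, List.map_map]
  congr 1
  congr 1
  apply List.map_congr_left
  intro k _
  simp only [Function.comp_apply]
  have : n + 1 - 1 - k.succ = n - 1 - k := by omega
  rw [this]

lemma coc_add (α : ℝ) (f : ℝ → ℝ) (E : ℝ) (n m : ℕ) (x : ℝ) :
    schCocycle α f E (n+m) x = schCocycle α f E m (x + n * α) * schCocycle α f E n x := by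
  induction m with
  | zero => rw [coc_zero, one_mul, add_zero]
  | succ m ih =>
    rw [← add_assoc, coc_succ, ih, coc_succ, mul_assoc]
    have : x + ((n + m : ℕ) : ℝ) * α = x + n * α + m * α := by push_cast; ring
    rw [this]

lemma coc_one (α : ℝ) (f : ℝ → ℝ) (E : ℝ) (x : ℝ) :
    schCocycle α f E 1 x = stepM E (f x) := by
  have := coc_succ α f E 0 x
  rw [coc_zero, mul_one] at this
  simpa using this

lemma coc_det (α : ℝ) (f : ℝ → ℝ) (E : ℝ) (n : ℕ) (x : ℝ) :
    (schCocycle α f E n x).det = 1 := by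
  induction n with
  | zero => rw [coc_zero, Matrix.det_one]
  | succ n ih => rw [coc_succ, Matrix.det_mul, ih, mul_one, stepM, Matrix.det_fin_two_of]; ring

lemma row_le (A : Matrix (Fin 2) (Fin 2) ℂ) (i : Fin 2) : ‖A i 0‖ + ‖A i 1‖ ≤ ‖A‖ := by
  rw [Matrix.linfty_opNorm_def]
  have h : (∑ j, ‖A i j‖₊) ≤ Finset.univ.sup fun i => ∑ j, ‖A i j‖₊ :=
    Finset.le_sup (f := fun i => ∑ j, ‖A i j‖₊) (Finset.mem_univ i)
  have h2 : ((∑ j, ‖A i j‖₊ : ℝ≥0) : ℝ) ≤ ((Finset.univ.sup fun i => ∑ j, ‖A i j‖₊ : ℝ≥0) : ℝ) := by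
    exact_mod_cast h
  simpa [Fin.sum_univ_two] using h2

lemma norm_le_of_rows (A : Matrix (Fin 2) (Fin 2) ℂ) (c : ℝ) 
    (h : ∀ i, ‖A i 0‖ + ‖A i 1‖ ≤ c) : ‖A‖ ≤ c := by
  have hc : 0 ≤ c := le_trans (by positivity) (h 0)
  rw [Matrix.linfty_opNorm_def]
  have h2 : (Finset.univ.sup fun i => ∑ j, ‖A i j‖₊) ≤ (⟨c, hc⟩ : ℝ≥0) := by
    apply Finset.sup_le
    intro i _
    have h3 : ((∑ j, ‖A i j‖₊ : ℝ≥0) : ℝ) ≤ c := by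
      simpa [Fin.sum_univ_two] using h i
    exact h3
  exact_mod_cast h2

lemma one_le_norm_of_det (A : Matrix (Fin 2) (Fin 2) ℂ) (h : A.det = 1) : 1 ≤ ‖A‖ := by
  have h0 := row_le A 0
  have h1 := row_le A 1
  rw [Matrix.det_fin_two] at h
  have h2 : (1:ℝ) ≤ ‖A 0 0‖ * ‖A 1 1‖ + ‖A 0 1‖ * ‖A 1 0‖ := by
    rw [← norm_mul, ← norm_mul, ← norm_one (α := ℂ), ← h]
    exact norm_sub_le _ _
  by_contra hlt
  push Not at hlt
  have a := norm_nonneg (A 0 0)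
  have b := norm_nonneg (A 0 1)
  have c := norm_nonneg (A 1 0)
  have d := norm_nonneg (A 1 1)
  have e := norm_nonneg A
  nlinarith [mul_nonneg a c, mul_nonneg b d, mul_nonneg a d, mul_nonneg b c,
    mul_le_mul h0 h1 (by positivity) e]

lemma coc_norm_ge (α : ℝ) (f : ℝ → ℝ) (E : ℝ) (n : ℕ) (x : ℝ) :
    1 ≤ ‖schCocycle α f E n x‖ := one_le_norm_of_det _ (coc_det α f E n x)

lemma stepM_norm (E v : ℝ) : ‖stepM E v‖ ≤ |E| + 1 + |v| := by
  apply norm_le_of_rows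
  intro i
  have h : ‖(E : ℂ) - (v : ℂ)‖ ≤ |E| + |v| := by
    refine (norm_sub_le _ _).trans ?_
    simp
  have hE := abs_nonneg E
  have hv := abs_nonneg v
  fin_cases i
  · simp [stepM]
    linarith
  · simp [stepM]
    linarith

lemma stepM_sub (E E' v v' : ℝ) : ‖stepM E v - stepM E' v'‖ ≤ |(E - v) - (E' - v')| := by
  apply norm_le_of_rows
  intro i
  fin_cases i
  · simp only [stepM, Matrix.sub_apply]
    simp
    have e : (E:ℂ)-v-(E' - v') = ((E - v - (E' - v') : ℝ):ℂ) := by push_cast; ring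
    rw [e, Complex.norm_real, Real.norm_eq_abs]
  · simp [stepM]

/-- a priori bound -/
def apriori (α : ℝ) (f : ℝ → ℝ) (A : ℝ) (n : ℕ) (x : ℝ) : ℝ :=
  ∏ j ∈ Finset.range n, (A + |f (x + j * α)|)

lemma apriori_ge (α : ℝ) (f : ℝ → ℝ) (A : ℝ) (hA : 1 ≤ A) (n : ℕ) (x : ℝ) :
    1 ≤ apriori α f A n x := by
  unfold apriori
  induction n with
  | zero => simp
  | succ n ih =>
    rw [Finset.prod_range_succ]
    have h1 : 1 ≤ A + |f (x + n * α)| := by linarith [abs_nonneg (f (x + n * α))]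
    nlinarith

lemma coc_le_apriori (α : ℝ) (f : ℝ → ℝ) (E A : ℝ) (hA : |E| + 1 ≤ A) (n : ℕ) (x : ℝ) :
    ‖schCocycle α f E n x‖ ≤ apriori α f A n x := by
  induction n with
  | zero =>
    rw [coc_zero, apriori]
    simp
  | succ n ih =>
    rw [coc_succ, apriori, Finset.prod_range_succ, mul_comm (∏ _ ∈ _, _)]
    refine (norm_mul_le _ _).trans ?_
    have h1 := stepM_norm E (f (x + n * α))
    apply mul_le_mul _ ih (norm_nonneg _) _
    · linarith
    · linarith [norm_nonneg (stepM E (f (x + n * α)))]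

lemma coc_pert (α : ℝ) (f : ℝ → ℝ) (E E' A r : ℝ) (hA : |E| + 1 ≤ A) (hA' : |E'| + 1 ≤ A)
    (hr : |E' - E| ≤ r) (n : ℕ) (x : ℝ) :
    ‖schCocycle α f E' n x - schCocycle α f E n x‖ ≤ r * (n * apriori α f A n x) := by
  induction n with
  | zero => simp [coc_zero]
  | succ n ih =>
    have hr0 : 0 ≤ r := (abs_nonneg _).trans hr
    have e : schCocycle α f E' (n+1) x - schCocycle α f E (n+1) x =
        stepM E' (f (x + n * α)) * (schCocycle α f E' n x - schCocycle α f E n x) +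
        (stepM E' (f (x + n * α)) - stepM E (f (x + n * α))) * schCocycle α f E n x := by
      rw [coc_succ, coc_succ, mul_sub, sub_mul]
      abel
    rw [e]
    have hP := apriori_ge α f A (by linarith [abs_nonneg E]) n x
    have h1 := stepM_norm E' (f (x + n * α))
    have h2 := stepM_sub E' E (f (x + n * α)) (f (x + n * α))
    have h2' : ‖stepM E' (f (x + n * α)) - stepM E (f (x + n * α))‖ ≤ r := by
      refine h2.trans (le_trans (le_of_eq ?_) hr)
      congr 1; ring
    have h3 := coc_le_apriori α f E A hA n x
    have hPs : apriori α f A (n+1) x = apriori α f A n x * (A + |f (x + n * α)|) := by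
      rw [apriori, Finset.prod_range_succ]; rfl
    rw [hPs]
    set P := apriori α f A n x
    set F := |f (x + n * α)|
    have hF : 0 ≤ F := abs_nonneg _
    have hA1 : 1 ≤ A := by linarith [abs_nonneg E]
    calc _ ≤ ‖stepM E' (f (x + n * α))‖ * ‖schCocycle α f E' n x - schCocycle α f E n x‖ +
          ‖stepM E' (f (x + n * α)) - stepM E (f (x + n * α))‖ * ‖schCocycle α f E n x‖ :=
        (norm_add_le _ _).trans (add_le_add (norm_mul_le _ _) (norm_mul_le _ _))
      _ ≤ (A + F) * (r * (n * P)) + r * P := by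
        apply add_le_add
        · apply mul_le_mul (by linarith) ih (norm_nonneg _) (by linarith)
        · apply mul_le_mul h2' h3 (norm_nonneg _) hr0
      _ ≤ (A + F) * (r * (n * P)) + r * (P * (A + F)) := by
        gcongr
        nlinarith
      _ = r * (((n + 1 : ℕ) : ℝ) * (P * (A + F))) := by push_cast; ring

lemma coc_diff (α : ℝ) (f : ℝ → ℝ) (E : ℝ) (n : ℕ) (y y' K d : ℝ) (hd0 : 0 ≤ d)
    (hd : ∀ j < n, |f (y' + j * α) - f (y + j * α)| ≤ d)
    (hK : ∀ j < n, ‖schCocycle α f E (n - 1 - j) (y' + (j + 1 : ℕ) * α)‖ *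
      ‖schCocycle α f E j y‖ ≤ K) :
    ‖schCocycle α f E n y' - schCocycle α f E n y‖ ≤ n * (d * K) := by
  set X : ℕ → Matrix (Fin 2) (Fin 2) ℂ := fun j =>
    schCocycle α f E (n - j) (y' + j * α) * schCocycle α f E j y with hX
  have h0 : X 0 = schCocycle α f E n y' := by simp [hX, coc_zero]
  have hn : X n = schCocycle α f E n y := by simp [hX, coc_zero]
  rw [← h0, ← hn, ← Finset.sum_range_sub' X n]
  refine (norm_sum_le_of_le _ (f := fun i => X i - X (i+1)) (n := fun _ => d * K) ?_).trans ?_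
  · intro j hj
    have hj' := Finset.mem_range.1 hj
    have e1 : n - j = 1 + (n - 1 - j) := by omega
    have e2 : n - (j + 1) = n - 1 - j := by omega
    have e3 : y' + j * α + (1 : ℕ) * α = y' + (j + 1 : ℕ) * α := by push_cast; ring
    have e : X j - X (j+1) = schCocycle α f E (n - 1 - j) (y' + (j + 1 : ℕ) * α) *
        ((stepM E (f (y' + j * α)) - stepM E (f (y + j * α))) * schCocycle α f E j y) := by
      simp only [hX]
      rw [e1, coc_add, e2, e3, coc_one, coc_succ, sub_mul, mul_sub, mul_assoc]
    rw [e]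
    have h1 : ‖stepM E (f (y' + j * α)) - stepM E (f (y + j * α))‖ ≤ d := by
      refine (stepM_sub _ _ _ _).trans (le_trans (le_of_eq ?_) (hd j hj'))
      rw [← abs_neg]
      congr 1; ring
    calc _ ≤ ‖schCocycle α f E (n - 1 - j) (y' + (j + 1 : ℕ) * α)‖ *
          (‖stepM E (f (y' + j * α)) - stepM E (f (y + j * α))‖ * ‖schCocycle α f E j y‖) :=
        (norm_mul_le _ _).trans (mul_le_mul_of_nonneg_left (norm_mul_le _ _) (norm_nonneg _))
      _ = ‖stepM E (f (y' + j * α)) - stepM E (f (y + j * α))‖ *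
          (‖schCocycle α f E (n - 1 - j) (y' + (j + 1 : ℕ) * α)‖ * ‖schCocycle α f E j y‖) := by
        ring
      _ ≤ d * K := mul_le_mul h1 (hK j hj') (by positivity) hd0
  · simp

/-! ### Subadditive averaging -/

lemma subadd_aux (u : ℕ → ℕ → ℝ) (N n : ℕ) (D : ℝ) (hN : 1 ≤ N) (hD0 : 0 ≤ D)
    (h0 : ∀ i m, 0 ≤ u i m) (h00 : ∀ i, u i 0 = 0)
    (hsub : ∀ i m k, u i (m + k) ≤ u i m + u (i + m) k)
    (hD : ∀ i m, i + m ≤ n → u i m ≤ m * D) (len : ℕ) :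
    ∀ i0, i0 + len = n → ∑ s ∈ Finset.range N, u (i0 + s) (len - s) ≤
      ∑ i ∈ Finset.range len, u (i0 + i) N + 2 * N ^ 2 * D := by
  induction len using Nat.strong_induction_on with
  | _ len ih =>
    intro i0 hi0
    rcases lt_or_ge len (2 * N) with hlt | hge
    · have hb : ∀ s ∈ Finset.range N, u (i0 + s) (len - s) ≤ 2 * N * D := by
        intro s hs
        rcases le_total s len with hsl | hsl
        · refine (hD _ _ (by omega)).trans ?_
          gcongr
          have : len - s ≤ 2 * N := by omega
          exact_mod_cast this
        · rw [Nat.sub_eq_zero_of_le hsl, h00]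
          positivity
      refine (Finset.sum_le_sum hb).trans ?_
      have : 0 ≤ ∑ i ∈ Finset.range len, u (i0 + i) N := Finset.sum_nonneg fun i _ => h0 _ _
      rw [Finset.sum_const, Finset.card_range, nsmul_eq_mul]
      nlinarith
    · obtain ⟨len', rfl⟩ : ∃ len', len = N + len' := ⟨len - N, by omega⟩
      have hb : ∀ s ∈ Finset.range N, u (i0 + s) (N + len' - s) ≤
          u (i0 + s) N + u (i0 + N + s) (len' - s) := by
        intro s hs
        have hs' := Finset.mem_range.1 hs
        have e1 : N + len' - s = N + (len' - s) := by omega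
        have e2 : i0 + N + s = i0 + s + N := by omega
        rw [e1, e2]
        exact hsub _ _ _
      refine (Finset.sum_le_sum hb).trans ?_
      rw [Finset.sum_add_distrib, Finset.sum_range_add]
      have := ih len' (by omega) (i0 + N) (by omega)
      simp only [← add_assoc]
      linarith

lemma subadd_avg (u : ℕ → ℕ → ℝ) (N n : ℕ) (D : ℝ) (hN : 1 ≤ N) (hD0 : 0 ≤ D)
    (h0 : ∀ i m, 0 ≤ u i m) (h00 : ∀ i, u i 0 = 0)
    (hsub : ∀ i m k, u i (m + k) ≤ u i m + u (i + m) k)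
    (hD : ∀ i m, i + m ≤ n → u i m ≤ m * D) :
    N * u 0 n ≤ ∑ i ∈ Finset.range n, u i N + 3 * N ^ 2 * D := by
  have hsum : 0 ≤ ∑ i ∈ Finset.range n, u i N := Finset.sum_nonneg fun i _ => h0 _ _
  have hN' : (1:ℝ) ≤ N := by exact_mod_cast hN
  rcases lt_or_ge n N with hlt | hge
  · have h1 := hD 0 n (by omega)
    have hn : (n:ℝ) ≤ N := by exact_mod_cast hlt.le
    have h2 : (N:ℝ) * u 0 n ≤ N * (N * D) := by
      gcongr
      exact h1.trans (by gcongr)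
    nlinarith [mul_nonneg (sq_nonneg (N:ℝ)) hD0]
  · have haux := subadd_aux u N n D hN hD0 h0 h00 hsub hD n 0 (by omega)
    simp only [zero_add] at haux
    have hb : ∀ s ∈ Finset.range N, u 0 n ≤ N * D + u s (n - s) := by
      intro s hs
      have hs' := Finset.mem_range.1 hs
      have h1 := hsub 0 s (n - s)
      rw [zero_add, Nat.add_sub_cancel' (by omega)] at h1
      have h2 := hD 0 s (by omega)
      have h3 : (s:ℝ) * D ≤ N * D := by
        gcongr
      linarith
    have := Finset.sum_le_sum hb
    rw [Finset.sum_const, Finset.card_range, nsmul_eq_mul, Finset.sum_add_distrib,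
      Finset.sum_const, Finset.card_range, nsmul_eq_mul] at this
    nlinarith

/-! ### The deterministic Gordon argument -/

open Matrix in
lemma solution_vec (α : ℝ) (f : ℝ → ℝ) (E x : ℝ) (ψ : ℤ → ℂ)
    (heq : ∀ m : ℤ, ψ (m + 1) + ψ (m - 1) + (f (x + m * α) : ℂ) * ψ m = (E : ℂ) * ψ m)
    (a : ℤ) (n : ℕ) :
    ![ψ (a + n), ψ (a + n - 1)] = schCocycle α f E n (x + a * α) *ᵥ ![ψ a, ψ (a - 1)] := by
  induction n with
  | zero => simp [coc_zero]
  | succ n ih =>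
    rw [coc_succ, ← Matrix.mulVec_mulVec, ← ih, stepM]
    have h := heq (a + n)
    have e : x + a * α + n * α = x + ((a + n : ℤ) : ℝ) * α := by push_cast; ring
    rw [e]
    have e1 : a + ((n + 1 : ℕ) : ℤ) = a + n + 1 := by push_cast; ring
    have e2 : a + (n:ℤ) + 1 - 1 = a + n := by ring
    rw [e1, e2]
    ext i
    fin_cases i
    · simp [Matrix.mulVec, dotProduct, Fin.sum_univ_two]
      push_cast at h
      linear_combination h
    · simp [Matrix.mulVec, dotProduct, Fin.sum_univ_two]

lemma trace_le (A : Matrix (Fin 2) (Fin 2) ℂ) : ‖A.trace‖ ≤ 2 * ‖A‖ := by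
  rw [Matrix.trace_fin_two]
  have h0 := row_le A 0
  have h1 := row_le A 1
  have := norm_add_le (A 0 0) (A 1 1)
  linarith [norm_nonneg (A 0 1), norm_nonneg (A 1 0)]

open Matrix in
lemma cayley_vec (A : Matrix (Fin 2) (Fin 2) ℂ) (h : A.det = 1) (v : Fin 2 → ℂ) :
    A *ᵥ (A *ᵥ v) = A.trace • (A *ᵥ v) - v := by
  rw [Matrix.det_fin_two] at h
  rw [Matrix.trace_fin_two]
  ext i
  fin_cases i
  · simp [Matrix.mulVec, dotProduct, Fin.sum_univ_two]
    linear_combination (- v 0) * h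
  · simp [Matrix.mulVec, dotProduct, Fin.sum_univ_two]
    linear_combination (- v 1) * h

open Matrix in
lemma mulVec_norm (A : Matrix (Fin 2) (Fin 2) ℂ) (v : Fin 2 → ℂ) : ‖A *ᵥ v‖ ≤ ‖A‖ * ‖v‖ :=
  Matrix.linfty_opNorm_mulVec A v

open Matrix in
lemma gordon_step (A B C : Matrix (Fin 2) (Fin 2) ℂ) (hA : A.det = 1) (hB : B.det = 1)
    (v0 vp v2 vm : Fin 2 → ℂ) (h1 : vp = A *ᵥ v0) (h2 : v2 = C *ᵥ vp) (h3 : v0 = B *ᵥ vm)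
    (η : ℝ) (hη : η ≤ 1 / 6) (hCA : ‖C - A‖ ≤ η) (hAB : ‖A - B‖ ≤ η) :
    ‖v0‖ ≤ 2 * (‖vp‖ + ‖v2‖ + ‖vm‖) := by
  have n0 := norm_nonneg v0
  have np := norm_nonneg vp
  have n2 := norm_nonneg v2
  have nm := norm_nonneg vm
  rcases le_or_gt ‖A.trace‖ 1 with ht | ht
  · have hc := cayley_vec A hA v0
    rw [← h1] at hc
    have e : v0 = A.trace • vp - v2 + (C - A) *ᵥ vp := by
      rw [Matrix.sub_mulVec, ← h2, hc]; abel
    have b1 : ‖A.trace • vp‖ ≤ ‖vp‖ := by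
      rw [norm_smul]; nlinarith
    have b2 : ‖(C - A) *ᵥ vp‖ ≤ ‖vp‖ := by
      refine (mulVec_norm _ _).trans ?_
      nlinarith
    have b3 : ‖v0‖ ≤ ‖A.trace • vp‖ + ‖v2‖ + ‖(C - A) *ᵥ vp‖ := by
      conv_lhs => rw [e]
      exact (norm_add_le _ _).trans (by gcongr; exact norm_sub_le _ _)
    linarith
  · have hc := cayley_vec B hB vm
    rw [← h3] at hc
    have e : B.trace • v0 = vp - (A - B) *ᵥ v0 + vm := by
      rw [Matrix.sub_mulVec, ← h1, hc]; abel
    have b1 : ‖(A - B) *ᵥ v0‖ ≤ 1 / 6 * ‖v0‖ := by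
      refine (mulVec_norm _ _).trans ?_
      gcongr
      linarith
    have b2 : 2 / 3 ≤ ‖B.trace‖ := by
      have := trace_le (A - B)
      rw [Matrix.trace_sub] at this
      have h5 := norm_sub_norm_le A.trace B.trace
      linarith
    have b3 : ‖B.trace‖ * ‖v0‖ ≤ ‖vp‖ + ‖(A - B) *ᵥ v0‖ + ‖vm‖ := by
      rw [← norm_smul, e]
      exact (norm_add_le _ _).trans (by gcongr; exact norm_sub_le _ _)
    nlinarith

lemma norm_vec2_le (a b : ℂ) : ‖![a, b]‖ ≤ ‖a‖ + ‖b‖ := by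
  rw [pi_norm_le_iff_of_nonneg (by positivity)]
  intro i
  fin_cases i
  · simp
  · simp

open Matrix in
lemma gordon (α : ℝ) (f : ℝ → ℝ) (E x : ℝ) (ψ : ℤ → ℂ)
    (heq : ∀ m : ℤ, ψ (m + 1) + ψ (m - 1) + (f (x + m * α) : ℂ) * ψ m = (E : ℂ) * ψ m)
    (hs : Summable (fun m : ℤ => ‖ψ m‖ ^ 2))
    (hfreq : ∃ᶠ q : ℕ in atTop,
      ‖schCocycle α f E q (x + q * α) - schCocycle α f E q x‖ ≤ 1 / 6 ∧
      ‖schCocycle α f E q x - schCocycle α f E q (x - q * α)‖ ≤ 1 / 6) : ψ = 0 := by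
  have hz : Tendsto (fun m : ℤ => ‖ψ m‖) cofinite (nhds 0) := by
    have h := hs.tendsto_cofinite_zero
    have h2 := (Real.continuous_sqrt.tendsto 0).comp h
    simpa [Function.comp_def, Real.sqrt_sq] using h2
  have hlim : ∀ g : ℕ → ℤ, Function.Injective g →
      Tendsto (fun q => ‖ψ (g q)‖) atTop (nhds 0) := by
    intro g hg
    rw [← Nat.cofinite_eq_atTop]
    exact hz.comp hg.tendsto_cofinite
  have hV : ∀ g : ℕ → ℤ, Function.Injective g →
      Tendsto (fun q => ‖![ψ (g q), ψ (g q - 1)]‖) atTop (nhds 0) := by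
    intro g hg
    have h1 := hlim g hg
    have h2 := hlim (fun q => g q - 1) (fun a b hab => hg (by simpa using hab))
    have h3 := h1.add h2
    rw [add_zero] at h3
    exact squeeze_zero (fun _ => norm_nonneg _) (fun q => norm_vec2_le _ _) h3
  have hp := hV (fun q => (q:ℤ)) (fun a b h => by simpa using h)
  have h2 := hV (fun q => (q:ℤ) + q) (fun a b h => by simp only at h; omega)
  have hm := hV (fun q => -(q:ℤ)) (fun a b h => by simpa using h)
  have hall := ((hp.add h2).add hm).const_mul 2
  have hle : ‖![ψ 0, ψ (0 - 1)]‖ ≤ 2 * (0 + 0 + 0) := by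
    refine ge_of_tendsto_of_frequently hall (hfreq.mono ?_)
    rintro q ⟨ha, hb⟩
    refine gordon_step (schCocycle α f E q x) (schCocycle α f E q (x - q * α))
      (schCocycle α f E q (x + q * α)) (coc_det _ _ _ _ _) (coc_det _ _ _ _ _) _ _ _ _ ?_ ?_ ?_
      (1/6) le_rfl ha hb
    · have := solution_vec α f E x ψ heq 0 q
      simpa using this
    · have := solution_vec α f E x ψ heq q q
      simpa using this
    · have := solution_vec α f E x ψ heq (-q) q
      simpa [sub_eq_add_neg] using this
  have h0 : ![ψ 0, ψ (0 - 1)] = 0 := by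
    rw [← norm_le_zero_iff]; simpa using hle
  have hpos : ∀ n : ℕ, ψ n = 0 := by
    intro n
    have := solution_vec α f E x ψ heq 0 n
    rw [h0, Matrix.mulVec_zero] at this
    have := congrFun this 0
    simpa using this
  have h00 : ψ 0 = 0 := by simpa using hpos 0
  have hneg : ∀ n : ℕ, ψ (-n) = 0 ∧ ψ (-n - 1) = 0 := by
    intro n
    induction n with
    | zero => 
      have := congrFun h0 1
      refine ⟨by simpa using h00, by simpa using this⟩
    | succ n ih =>
      have h := heq (-n - 1)
      have e1 : (-(n:ℤ) - 1 + 1) = -n := by ring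
      have e2 : (-((n+1 : ℕ):ℤ)) = -n - 1 := by push_cast; ring
      rw [e1, ih.1, ih.2] at h
      rw [e2]
      exact ⟨ih.2, by simpa using h⟩
  funext m
  rcases Int.eq_nat_or_neg m with ⟨n, rfl | rfl⟩
  · exact hpos n
  · exact (hneg n).1

/-! ### Measurability and integrability -/

lemma f_meas {f : ℝ → ℝ} (hp : Function.Periodic f 1) (hmono : MonotoneOn f (Set.Ico 0 1)) :
    Measurable f := by
  apply measurable_of_Iio
  intro a
  have e : f ⁻¹' Set.Iio a = Int.fract ⁻¹' {y | y ∈ Set.Ico (0:ℝ) 1 ∧ f y < a} := by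
    ext x
    have h : f (Int.fract x) = f x := by
      have := hp.sub_int_mul_eq (x := x) ⌊x⌋
      rw [mul_one] at this
      exact this
    simp only [Set.mem_preimage, Set.mem_Iio, Set.mem_ofPred_eq, h, Set.mem_Ico]
    exact ⟨fun h => ⟨⟨Int.fract_nonneg x, Int.fract_lt_one x⟩, h⟩, fun h => h.2⟩
  rw [e]
  apply measurable_fract
  apply Set.OrdConnected.measurableSet
  constructor
  rintro x ⟨hx, hx2⟩ y ⟨hy, hy2⟩ z ⟨hz1, hz2⟩
  have hz : z ∈ Set.Ico (0:ℝ) 1 := ⟨hx.1.trans hz1, hz2.trans_lt hy.2⟩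
  exact ⟨hz, (hmono hz hy hz2).trans_lt hy2⟩

lemma per_integrable {h : ℝ → ℝ} (hp : Function.Periodic h 1) (hm : Measurable h)
    (hi : Integrable h unu) (a : ℝ) : Integrable (fun x => h (x + a)) unu := by
  refine ⟨(hm.comp (measurable_id.add_const a)).aestronglyMeasurable, ?_⟩
  have h2 := hi.2
  unfold HasFiniteIntegral at h2 ⊢
  have := per_lintegral (w := fun x => ‖h x‖ₑ) (fun x => by simp only [hp x]) a
  rw [this]
  exact h2

lemma coc_entry_meas (α : ℝ) {f : ℝ → ℝ} (hm : Measurable f) (E : ℝ) (n : ℕ) :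
    ∀ i j, Measurable (fun x => schCocycle α f E n x i j) := by
  induction n with
  | zero => intro i j; simp only [coc_zero]; exact measurable_const
  | succ n ih =>
    intro i j
    have hf : Measurable fun x => ((f (x + n * α) : ℝ) : ℂ) :=
      Complex.measurable_ofReal.comp (hm.comp (measurable_id.add_const _))
    simp only [coc_succ, Matrix.mul_apply, Fin.sum_univ_two]
    have h0 := ih 0 j
    have h1 := ih 1 j
    fin_cases i
    · simp [stepM]
      fun_prop
    · simp [stepM]
      fun_prop

lemma norm_eq_rows (A : Matrix (Fin 2) (Fin 2) ℂ) :
    ‖A‖ = max (‖A 0 0‖ + ‖A 0 1‖) (‖A 1 0‖ + ‖A 1 1‖) := by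
  apply le_antisymm
  · apply norm_le_of_rows
    intro i
    fin_cases i
    · exact le_max_left _ _
    · exact le_max_right _ _
  · exact max_le (row_le A 0) (row_le A 1)

lemma coc_norm_meas (α : ℝ) {f : ℝ → ℝ} (hm : Measurable f) (E : ℝ) (n : ℕ) :
    Measurable (fun x => ‖schCocycle α f E n x‖) := by
  simp only [norm_eq_rows]
  have h00 := coc_entry_meas α hm E n 0 0
  have h01 := coc_entry_meas α hm E n 0 1
  have h10 := coc_entry_meas α hm E n 1 0
  have h11 := coc_entry_meas α hm E n 1 1
  fun_prop

lemma coc_periodic (α : ℝ) {f : ℝ → ℝ} (hp : Function.Periodic f 1) (E : ℝ) (n : ℕ) :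
    Function.Periodic (schCocycle α f E n) 1 := by
  intro x
  unfold schCocycle
  congr 1
  apply List.map_congr_left
  intro k _
  have e : ∀ t, f (x + 1 + t) = f (x + t) := by
    intro t
    rw [show x + 1 + t = x + t + 1 by ring]
    exact hp _
  rw [e]

lemma apriori_periodic (α : ℝ) {f : ℝ → ℝ} (hp : Function.Periodic f 1) (A : ℝ) (n : ℕ) :
    Function.Periodic (apriori α f A n) 1 := by
  intro x
  unfold apriori
  apply Finset.prod_congr rfl
  intro k _
  rw [show x + 1 + k * α = x + k * α + 1 by ring, hp]

lemma apriori_meas (α : ℝ) {f : ℝ → ℝ} (hm : Measurable f) (A : ℝ) (n : ℕ) :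
    Measurable (apriori α f A n) := by
  unfold apriori
  fun_prop

lemma log_apriori (α : ℝ) (f : ℝ → ℝ) (A : ℝ) (hA : 1 ≤ A) (n : ℕ) (x : ℝ) :
    Real.log (apriori α f A n x) ≤
      ∑ j ∈ Finset.range n, (Real.log A + Real.log (1 + |f (x + j * α)|)) := by
  unfold apriori
  rw [Real.log_prod (fun j _ => by positivity)]
  apply Finset.sum_le_sum
  intro j _
  have h := abs_nonneg (f (x + j * α))
  rw [← Real.log_mul (by positivity) (by positivity)]
  apply Real.log_le_log (by positivity)
  nlinarith

lemma log_apriori_int (α : ℝ) {f : ℝ → ℝ} (hp : Function.Periodic f 1) (hm : Measurable f)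
    (hi : Integrable (fun x => Real.log (1 + |f x|)) unu) (A : ℝ) (n : ℕ) :
    Integrable (fun x => ∑ j ∈ Finset.range n,
      (Real.log A + Real.log (1 + |f (x + j * α)|))) unu := by
  apply integrable_finsetSum
  intro j _
  apply (integrable_const _).add
  exact per_integrable (h := fun x => Real.log (1 + |f x|)) (fun x => by simp only [hp x])
    (by fun_prop) hi _

lemma exists_G (α : ℝ) {f : ℝ → ℝ} (hp : Function.Periodic f 1) (hm : Measurable f)
    (hi : Integrable (fun x => Real.log (1 + |f x|)) unu) (E0 c : ℝ) (N : ℕ)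
    (hc : ∫ x, Real.log ‖schCocycle α f E0 N x‖ ∂unu < c) :
    ∃ r : ℝ, 0 < r ∧ r ≤ 1 ∧ ∃ G : ℝ → ℝ, Function.Periodic G 1 ∧ Measurable G ∧
      Integrable G unu ∧ ∫ x, G x ∂unu < c ∧ (∀ y, 0 ≤ G y) ∧
      ∀ E', |E' - E0| ≤ r → ∀ y, Real.log ‖schCocycle α f E' N y‖ ≤ G y := by
  set A := |E0| + 2 with hA
  have hA1 : 1 ≤ A := by linarith [abs_nonneg E0]
  set P := apriori α f A N with hP
  set g : ℝ → ℝ → ℝ := fun r y => Real.log (‖schCocycle α f E0 N y‖ + r * (N * P y)) with hg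
  set D : ℝ → ℝ := fun x => Real.log (N + 1) + ∑ j ∈ Finset.range N,
      (Real.log A + Real.log (1 + |f (x + j * α)|)) with hD
  have hDi : Integrable D unu := (integrable_const _).add (log_apriori_int α hp hm hi A N)
  have hPge : ∀ y, 1 ≤ P y := apriori_ge α f A hA1 N
  have hSge := coc_norm_ge α f E0 N
  have hgm : ∀ r, Measurable (g r) := by
    intro r
    have h1 := coc_norm_meas α hm E0 N
    have h2 := apriori_meas α hm A N
    exact (h1.add ((h2.const_mul _).const_mul _)).log
  have hg0 : ∀ r, 0 ≤ r → ∀ y, 0 ≤ g r y := by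
    intro r hr y
    apply Real.log_nonneg
    have : 0 ≤ r * (N * P y) := mul_nonneg hr (mul_nonneg (by positivity) (by linarith [hPge y]))
    linarith [hSge y]
  have hgD : ∀ r, 0 ≤ r → r ≤ 1 → ∀ y, g r y ≤ D y := by
    intro r hr hr1 y
    have h1 := log_apriori α f A hA1 N y
    have h2 := coc_le_apriori α f E0 A (by linarith) N y
    have h3 := hPge y
    have h4 : 0 ≤ N * P y := mul_nonneg (by positivity) (by linarith [hPge y])
    have h5 : 0 ≤ r * (N * P y) := mul_nonneg hr h4
    have h6 : g r y ≤ Real.log ((N + 1) * P y) := by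
      apply Real.log_le_log (by linarith [hSge y])
      nlinarith
    rw [Real.log_mul (by positivity) (by positivity)] at h6
    simp only [hD]
    linarith
  have hbd : ∀ r, 0 ≤ r → r ≤ 1 → ∀ y, ‖g r y‖ ≤ D y := by
    intro r hr hr1 y
    rw [Real.norm_eq_abs, abs_of_nonneg (hg0 r hr y)]
    exact hgD r hr hr1 y
  have hlim : Tendsto (fun k : ℕ => ∫ y, g (1 / ((k:ℝ) + 1)) y ∂unu) atTop
      (nhds (∫ x, Real.log ‖schCocycle α f E0 N x‖ ∂unu)) := by
    apply tendsto_integral_of_dominated_convergence D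
    · intro k; exact (hgm _).aestronglyMeasurable
    · exact hDi
    · intro k
      refine Eventually.of_forall (hbd _ (by positivity) ?_)
      rw [div_le_one (by positivity)]
      linarith [(Nat.cast_nonneg k : (0:ℝ) ≤ k)]
    · refine Eventually.of_forall fun y => ?_
      have h1 := (tendsto_one_div_add_atTop_nhds_zero_nat (𝕜 := ℝ)).mul_const (N * P y)
      have h2 := h1.const_add ‖schCocycle α f E0 N y‖
      rw [zero_mul, add_zero] at h2
      exact h2.log (by linarith [hSge y])
  obtain ⟨k, hk⟩ := (hlim.eventually (gt_mem_nhds hc)).exists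
  have hr0 : (0:ℝ) < 1 / ((k:ℝ) + 1) := by positivity
  have hr1 : 1 / ((k:ℝ) + 1) ≤ 1 := by
    rw [div_le_one (by positivity)]
    linarith [(Nat.cast_nonneg k : (0:ℝ) ≤ k)]
  refine ⟨1 / ((k:ℝ) + 1), hr0, hr1, g (1 / ((k:ℝ) + 1)), ?_, hgm _, ?_, hk, hg0 _ hr0.le, ?_⟩
  · intro y
    simp only [hg, hP, coc_periodic α hp E0 N y, apriori_periodic α hp A N y]
  · exact hDi.mono' (hgm _).aestronglyMeasurable
      (Eventually.of_forall (hbd _ hr0.le hr1))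
  · intro E' hE' y
    have hEA : |E'| + 1 ≤ A := by
      have := abs_sub_abs_le_abs_sub E' E0
      linarith
    have h := coc_pert α f E0 E' A _ (by linarith) hEA hE' N y
    apply Real.log_le_log (by linarith [coc_norm_ge α f E' N y])
    have h2 := norm_sub_norm_le (schCocycle α f E' N y) (schCocycle α f E0 N y)
    linarith

/-! ### Assembly -/

lemma log_coc_le (α : ℝ) (f : ℝ → ℝ) (E A t : ℝ) (hA : |E| + 1 ≤ A) (y : ℝ) (M : ℕ)
    (h1 : ∀ j < M, Real.log (1 + |f (y + j * α)|) ≤ t) (i m : ℕ) (him : i + m ≤ M) :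
    Real.log ‖schCocycle α f E m (y + i * α)‖ ≤ m * (Real.log A + t) := by
  have hA1 : 1 ≤ A := by linarith [abs_nonneg E]
  have h2 := coc_le_apriori α f E A hA m (y + i * α)
  have h3 := Real.log_le_log (by linarith [coc_norm_ge α f E m (y + i * α)]) h2
  refine h3.trans ((log_apriori α f A hA1 m (y + i * α)).trans ?_)
  have h4 : ∀ j ∈ Finset.range m,
      Real.log A + Real.log (1 + |f (y + i * α + j * α)|) ≤ Real.log A + t := by
    intro j hj
    have hj' := Finset.mem_range.1 hj
    have h5 := h1 (i + j) (by omega)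
    have e : y + ((i + j : ℕ) : ℝ) * α = y + i * α + j * α := by push_cast; ring
    rw [e] at h5
    linarith
  refine (Finset.sum_le_sum h4).trans ?_
  rw [Finset.sum_const, Finset.card_range, nsmul_eq_mul]

lemma log_coc_avg (α : ℝ) (f : ℝ → ℝ) (E D : ℝ) (y : ℝ) (n N : ℕ) (hN : 1 ≤ N) (hD0 : 0 ≤ D)
    (G : ℝ → ℝ) (hG : ∀ y, Real.log ‖schCocycle α f E N y‖ ≤ G y)
    (hD : ∀ i m, i + m ≤ n → Real.log ‖schCocycle α f E m (y + i * α)‖ ≤ m * D) :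
    N * Real.log ‖schCocycle α f E n y‖ ≤
      ∑ i ∈ Finset.range n, G (y + i * α) + 3 * N ^ 2 * D := by
  have h := subadd_avg (fun i m => Real.log ‖schCocycle α f E m (y + i * α)‖) N n D hN hD0
    (fun i m => Real.log_nonneg (coc_norm_ge _ _ _ _ _))
    (fun i => by
      have : ‖(1 : Matrix (Fin 2) (Fin 2) ℂ)‖ = 1 := by
        rw [norm_eq_rows]; simp
      simp only [coc_zero, this, Real.log_one])
    (fun i m k => by
      have h1 := coc_norm_ge α f E m (y + i * α)
      have h2 := coc_norm_ge α f E k (y + (i + m : ℕ) * α)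
      have h3 := coc_norm_ge α f E (m + k) (y + i * α)
      rw [← Real.log_mul (by linarith) (by linarith), mul_comm ‖_‖]
      apply Real.log_le_log (by linarith)
      rw [coc_add]
      have e : y + i * α + m * α = y + (i + m : ℕ) * α := by push_cast; ring
      rw [e]
      exact norm_mul_le _ _)
    hD
  simp only [Nat.cast_zero, zero_mul, add_zero] at h
  refine h.trans ?_
  gcongr
  exact hG _

lemma good_diff (α : ℝ) (f : ℝ → ℝ) (E A t c d y : ℝ) (q N : ℕ) (hN : 1 ≤ N)
    (hA : |E| + 1 ≤ A) (ht : 0 ≤ t) (hd0 : 0 ≤ d)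
    (G : ℝ → ℝ) (hG0 : ∀ y, 0 ≤ G y) (hG : ∀ y, Real.log ‖schCocycle α f E N y‖ ≤ G y)
    (h1 : ∀ j < 2 * q, Real.log (1 + |f (y + j * α)|) ≤ t)
    (h2 : ∑ i ∈ Finset.range q, max (G (y + i * α)) (G (y + q * α + i * α)) ≤ N * c * q)
    (h3 : ∀ j < q, |f (y + j * α + q * α) - f (y + j * α)| ≤ d) :
    ‖schCocycle α f E q (y + q * α) - schCocycle α f E q y‖ ≤
      q * (d * Real.exp (c * q + 6 * N * (Real.log A + t))) := by
  have hA1 : 1 ≤ A := by linarith [abs_nonneg E]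
  set D := Real.log A + t with hD
  have hD0 : 0 ≤ D := add_nonneg (Real.log_nonneg hA1) ht
  have hN' : (1:ℝ) ≤ N := by exact_mod_cast hN
  apply coc_diff α f E q y (y + q * α) _ d hd0
  · intro j hj
    rw [show y + q * α + j * α = y + j * α + q * α by ring]
    exact h3 j hj
  · intro j hj
    set n' := q - 1 - j with hn'
    have a1 := log_coc_avg α f E D y j N hN hD0 G hG
      (fun i m him => log_coc_le α f E A t hA y (2 * q) h1 i m (by omega))
    have a2 := log_coc_avg α f E D (y + q * α + (j + 1 : ℕ) * α) n' N hN hD0 G hG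
      (fun i m him => by
        have := log_coc_le α f E A t hA y (2 * q) h1 (q + (j + 1) + i) m (by omega)
        have e : y + ((q + (j + 1) + i : ℕ) : ℝ) * α =
          y + q * α + (j + 1 : ℕ) * α + i * α := by push_cast; ring
        rw [e] at this
        exact this)
    have hsum : ∑ i ∈ Finset.range j, G (y + i * α) +
        ∑ i ∈ Finset.range n', G (y + q * α + (j + 1 : ℕ) * α + i * α) ≤ N * c * q := by
      refine le_trans ?_ h2
      have eq1 : q = j + (1 + n') := by omega
      conv_rhs => rw [eq1, Finset.sum_range_add, Finset.sum_range_add]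
      have b1 : ∑ i ∈ Finset.range j, G (y + i * α) ≤
          ∑ i ∈ Finset.range j, max (G (y + i * α)) (G (y + ((j + (1 + n') : ℕ) : ℝ) * α + i * α)) :=
        Finset.sum_le_sum fun i _ => le_max_left _ _
      have b2 : ∑ i ∈ Finset.range n', G (y + q * α + (j + 1 : ℕ) * α + i * α) ≤
          ∑ i ∈ Finset.range n', max (G (y + ((j + (1 + i) : ℕ) : ℝ) * α))
            (G (y + ((j + (1 + n') : ℕ) : ℝ) * α + ((j + (1 + i) : ℕ) : ℝ) * α)) := by
        apply Finset.sum_le_sum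
        intro i _
        refine le_trans (le_of_eq ?_) (le_max_right _ _)
        rw [← eq1]
        congr 1
        push_cast
        ring
      have b3 : 0 ≤ ∑ i ∈ Finset.range 1, max (G (y + ((j + i : ℕ) : ℝ) * α))
            (G (y + ((j + (1 + n') : ℕ) : ℝ) * α + ((j + i : ℕ) : ℝ) * α)) :=
        Finset.sum_nonneg fun i _ => le_trans (hG0 _) (le_max_left _ _)
      linarith
    have g1 := coc_norm_ge α f E j y
    have g2 := coc_norm_ge α f E n' (y + q * α + (j + 1 : ℕ) * α)
    rw [← Real.log_le_iff_le_exp (by nlinarith), Real.log_mul (by linarith) (by linarith)]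
    have : (N:ℝ) * (Real.log ‖schCocycle α f E n' (y + q * α + (j + 1 : ℕ) * α)‖ +
        Real.log ‖schCocycle α f E j y‖) ≤ N * (c * q + 6 * N * D) := by
      nlinarith
    exact le_of_mul_le_mul_left this (by linarith)

lemma freq_good (B : ℕ → Set ℝ) (Q : Set ℕ) [hne : NeBot (atTop ⊓ 𝓟 Q)]
    (h : Tendsto (fun q => unu (B q)) (atTop ⊓ 𝓟 Q) (nhds 0)) :
    ∀ᵐ x ∂unu, ∃ᶠ q in atTop ⊓ 𝓟 Q, x ∉ B q := by
  have hT : ∀ n : ℕ, unu {x | ∀ q, n ≤ q → q ∈ Q → x ∈ B q} = 0 := by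
    intro n
    apply le_antisymm _ (zero_le)
    refine ge_of_tendsto h ?_
    rw [eventually_inf_principal]
    filter_upwards [eventually_ge_atTop n] with q hq hqQ
    exact measure_mono fun x hx => hx q hq hqQ
  have : ∀ n : ℕ, ∀ᵐ x ∂unu, ¬ ∀ q, n ≤ q → q ∈ Q → x ∈ B q := by
    intro n
    rw [ae_iff]
    simpa using hT n
  rw [← ae_all_iff] at this
  filter_upwards [this] with x hx
  intro hev
  rw [eventually_inf_principal, eventually_atTop] at hev
  obtain ⟨n, hn⟩ := hev
  apply hx n
  intro q hq hqQ
  have := hn q hq hqQ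
  simpa using this


/-- the bad set of phases at scale `q` with base shift `s q` -/
def badSet (α : ℝ) (f G : ℝ → ℝ) (κ b ε ε' : ℝ) (s : ℕ → ℝ) (q : ℕ) : Set ℝ :=
  {x | ∃ j < 2 * q, ε' * q < (fun y => Real.log (1 + |f y|)) (x + s q + j * α)} ∪
  {x | κ * q ≤ ∑ i ∈ Finset.range q,
      max (G (x + s q + i * α)) (G (x + s q + q * α + i * α))} ∪
  {x | ∃ j < q,
      Real.exp (-((b - ε) * q)) < |f (x + s q + j * α + q * α) - f (x + s q + j * α)| ∧
      |f (x + s q + j * α)| ≤ Real.exp (ε' * q) ∧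
      |f (x + s q + j * α + q * α)| ≤ Real.exp (ε' * q)}

lemma good_of_not_bad (α : ℝ) (f : ℝ → ℝ) (E A c b ε ε' x : ℝ) (s : ℕ → ℝ) (q N : ℕ)
    (hN : 1 ≤ N) (hA : |E| + 1 ≤ A) (hε' : 0 ≤ ε')
    (G : ℝ → ℝ) (hG0 : ∀ y, 0 ≤ G y) (hG : ∀ y, Real.log ‖schCocycle α f E N y‖ ≤ G y)
    (hx : x ∉ badSet α f G (N * c) b ε ε' s q) :
    ‖schCocycle α f E q (x + s q + q * α) - schCocycle α f E q (x + s q)‖ ≤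
      Real.exp (6 * N * Real.log A) * (q * Real.exp (-((b - ε - c - 6 * N * ε') * q))) := by
  simp only [badSet, Set.mem_union, not_or, Set.mem_ofPred_eq, not_exists, not_and, not_lt,
    not_le] at hx
  obtain ⟨⟨hx1, hx2⟩, hx3⟩ := hx
  have hsm : ∀ j < 2 * q, |f (x + s q + j * α)| ≤ Real.exp (ε' * q) := by
    intro j hj
    have h := hx1 j hj
    have h0 := abs_nonneg (f (x + s q + j * α))
    rw [Real.log_le_iff_le_exp (by positivity)] at h
    linarith
  have h := good_diff α f E A (ε' * q) c (Real.exp (-((b - ε) * q))) (x + s q) q N hN hA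
    (by positivity) (Real.exp_pos _).le G hG0 hG hx1 hx2.le (by
      intro j hj
      by_contra hlt
      push Not at hlt
      have h1 := hsm j (by omega)
      have h2 := hsm (j + q) (by omega)
      have e : x + s q + ((j + q : ℕ) : ℝ) * α = x + s q + j * α + q * α := by push_cast; ring
      rw [e] at h2
      exact absurd h2 (not_le.2 (hx3 j hj hlt h1)))
  refine h.trans (le_of_eq ?_)
  rw [← Real.exp_add, mul_left_comm, ← Real.exp_add]
  congr 2
  ring

lemma bad_small {α : ℝ} (hα : Irrational α) {f : ℝ → ℝ} (hp : Function.Periodic f 1)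
    (hmono : MonotoneOn f (Set.Ico 0 1))
    (hi : Integrable (fun x => Real.log (1 + |f x|)) unu)
    {G : ℝ → ℝ} (hGp : Function.Periodic G 1) (hGm : Measurable G) (hGi : Integrable G unu)
    (κ b ε ε' : ℝ) (hκ : ∫ x, G x ∂unu < κ) (hε' : 0 < ε') (hε : ε' < ε) (hb : 0 < b)
    (s : ℕ → ℝ) (l : Filter ℕ) (hl : l ≤ atTop)
    (hl3 : ∀ᶠ q : ℕ in l, ∃ p : ℤ, |q * α - p| ≤ Real.exp (-(b * q))) :
    Tendsto (fun q => unu (badSet α f G κ b ε ε' s q)) l (nhds 0) := by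
  have hm := f_meas hp hmono
  have hl2 : Tendsto (fun q : ℕ => (((q * α : ℝ)) : UnitAddCircle)) l (nhds 0) := by
    rw [tendsto_zero_iff_norm_tendsto_zero]
    have hexp : Tendsto (fun q : ℕ => Real.exp (-(b * q))) l (nhds 0) := by
      have h1 : Tendsto (fun q : ℕ => b * (q:ℝ)) atTop atTop :=
        tendsto_natCast_atTop_atTop.const_mul_atTop hb
      exact (Real.tendsto_exp_neg_atTop_nhds_zero.comp h1).mono_left hl
    refine squeeze_zero' (Eventually.of_forall fun _ => norm_nonneg _) ?_ hexp
    filter_upwards [hl3] with q hq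
    obtain ⟨p, hp⟩ := hq
    have e : ((q * α : ℝ) : UnitAddCircle) = ((q * α - p : ℝ) : UnitAddCircle) := by
      rw [AddCircle.coe_sub]
      have : ((p : ℝ) : UnitAddCircle) = 0 := by
        rw [AddCircle.coe_eq_zero_iff]
        exact ⟨p, by simp⟩
      rw [this, sub_zero]
    rw [e]
    refine le_trans ?_ hp
    rw [UnitAddCircle.norm_eq]
    have := round_le (q * α - p) 0
    simpa using this
  have t1 := (tail_small (h := fun y => Real.log (1 + |f y|)) (fun x => by simp only [hp x])
    (by fun_prop) hi α ε' hε' s).mono_left hl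
  have t2 := erg_small hGp hGm hGi hα κ hκ s l hl hl2
  have t3 := diff_small hp hmono hm α b ε ε' hε s l hl hl3
  have t := (t1.add t2).add t3
  simp only [add_zero] at t
  refine tendsto_of_tendsto_of_tendsto_of_le_of_le tendsto_const_nhds t (fun _ => zero_le) ?_
  intro q
  refine (measure_union_le _ _).trans ?_
  exact add_le_add (measure_union_le _ _) le_rfl

lemma core {α : ℝ} (hα : Irrational α) {f : ℝ → ℝ} (hp : Function.Periodic f 1)
    (hmono : MonotoneOn f (Set.Ico 0 1))
    (hi : Integrable (fun x => Real.log (1 + |f x|)) unu)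
    (E0 c b : ℝ) (hb0 : 0 < b) (hcb : c < b) (hbβ : (b : EReal) < cfBeta α)
    (N : ℕ) (hN : 1 ≤ N)
    (hc : ∫ x, Real.log ‖schCocycle α f E0 N x‖ ∂unu < N * c) :
    ∃ r : ℝ, 0 < r ∧ ∀ᵐ x ∂unu, ∀ E', |E' - E0| ≤ r →
      ∃ᶠ q : ℕ in atTop,
      ‖schCocycle α f E' q (x + q * α) - schCocycle α f E' q x‖ ≤ 1 / 6 ∧
      ‖schCocycle α f E' q x - schCocycle α f E' q (x - q * α)‖ ≤ 1 / 6 := by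
  have hm := f_meas hp hmono
  obtain ⟨r, hr0, hr1, G, hGp, hGm, hGi, hGc, hG0, hG⟩ := exists_G α hp hm hi E0 (N * c) N hc
  refine ⟨r, hr0, ?_⟩
  have hN' : (1:ℝ) ≤ N := by exact_mod_cast hN
  set δ := b - c with hδ
  have hδ0 : 0 < δ := by linarith
  set ε := δ / 4 with hε
  set ε' := δ / (24 * N) with hε'
  have hε'0 : 0 < ε' := by positivity
  have hNε : 6 * N * ε' = δ / 4 := by rw [hε']; field_simp; norm_num
  have hεε : ε' < ε := by nlinarith
  set A := |E0| + 2 with hA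
  set Q : Set ℕ := {q | ∃ p : ℤ, |q * α - p| ≤ Real.exp (-(b * q))} with hQ
  have hne : NeBot (atTop ⊓ 𝓟 Q) := by
    rw [← frequently_mem_iff_neBot]
    exact cf_frequently hα b hbβ
  have hl3 : ∀ᶠ q : ℕ in atTop ⊓ 𝓟 Q, ∃ p : ℤ, |q * α - p| ≤ Real.exp (-(b * q)) :=
    eventually_inf_principal.2 (Eventually.of_forall fun q hq => hq)
  have B1 := bad_small hα hp hmono hi hGp hGm hGi (N * c) b ε ε' hGc hε'0 hεε hb0 (fun _ => 0)
    _ inf_le_left hl3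
  have B2 := bad_small hα hp hmono hi hGp hGm hGi (N * c) b ε ε' hGc hε'0 hεε hb0
    (fun q => -(q * α)) _ inf_le_left hl3
  have B := B1.add B2
  rw [add_zero] at B
  have B' : Tendsto (fun q => unu (badSet α f G (N * c) b ε ε' (fun _ => 0) q ∪
      badSet α f G (N * c) b ε ε' (fun q => -(q * α)) q)) (atTop ⊓ 𝓟 Q) (nhds 0) :=
    tendsto_of_tendsto_of_tendsto_of_le_of_le tendsto_const_nhds B (fun _ => zero_le)
      (fun q => measure_union_le _ _)
  filter_upwards [freq_good _ Q B'] with x hx E' hE'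
  have hEA : |E'| + 1 ≤ A := by
    have := abs_sub_abs_le_abs_sub E' E0
    linarith
  have hx' := hx.filter_mono inf_le_left
  have hη := exp_small (δ / 2) (by positivity) (Real.exp (6 * N * Real.log A))
  have hη' := hη.eventually (gt_mem_nhds (show (0:ℝ) < 1 / 6 by norm_num))
  refine (hx'.and_eventually hη').mono ?_
  rintro q ⟨hq, hq2⟩
  rw [Set.mem_union, not_or] at hq
  have e : b - ε - c - 6 * N * ε' = δ / 2 := by rw [hNε, hε, hδ]; ring
  have g1 := good_of_not_bad α f E' A c b ε ε' x _ q N hN hEA hε'0.le G hG0 (hG E' hE') hq.1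
  have g2 := good_of_not_bad α f E' A c b ε ε' x _ q N hN hEA hε'0.le G hG0 (hG E' hE') hq.2
  rw [e] at g1 g2
  simp only [add_zero] at g1
  simp only [← sub_eq_add_neg, sub_add_cancel] at g2
  exact ⟨g1.trans hq2.le, g2.trans hq2.le⟩

/-- (Sharp arithmetic Gordon theorem for monotone potentials.) Let `α` be
irrational and `f : ℝ → ℝ` a `1`-periodic function, non-decreasing on `[0,1)`, with
`∫₀¹ log(1+|f|) < ∞`, and let `L E` be the Lyapunov exponent of the Schrödinger cocycle.
Then for a.e. `x ∈ [0,1)`, no `E` with `0 < L(E) < β(α)` is an eigenvalue of `H(x)`. -/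
theorem sharp_gordon_monotone (α : ℝ) (hα : Irrational α) (f : ℝ → ℝ)
    (hper : Function.Periodic f 1) (hmono : MonotoneOn f (Set.Ico 0 1))
    (hlog : IntegrableOn (fun x => Real.log (1 + |f x|)) (Set.Ico 0 1) volume)
    (L : ℝ → ℝ)
    (hL : ∀ E : ℝ, Tendsto
      (fun n : ℕ => (1 / n : ℝ) * ∫ x in Set.Ico (0:ℝ) 1, Real.log ‖schCocycle α f E n x‖)
      atTop (nhds (L E))) :
    ∀ᵐ x ∂(volume.restrict (Set.Ico (0:ℝ) 1)), ∀ E : ℝ,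
      0 < L E → ((L E : ℝ) : EReal) < cfBeta α →
      ¬ ∃ ψ : ℤ → ℂ, ψ ≠ 0 ∧ Summable (fun m : ℤ => ‖ψ m‖ ^ 2) ∧
        ∀ m : ℤ, ψ (m + 1) + ψ (m - 1) + (f (x + m * α) : ℂ) * ψ m = (E : ℂ) * ψ m := by
  have hi : Integrable (fun x => Real.log (1 + |f x|)) unu := hlog
  have key : ∀ c b : ℚ, ∀ᵐ x ∂unu, 0 < (b:ℝ) → (c:ℝ) < b → (((b:ℝ)) : EReal) < cfBeta α →
      ∀ E : ℝ, L E < c → ∃ᶠ q : ℕ in atTop,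
      ‖schCocycle α f E q (x + q * α) - schCocycle α f E q x‖ ≤ 1 / 6 ∧
      ‖schCocycle α f E q x - schCocycle α f E q (x - q * α)‖ ≤ 1 / 6 := by
    intro c b
    by_cases hb0 : 0 < (b:ℝ)
    swap
    · exact Eventually.of_forall fun x h => absurd h hb0
    by_cases hcb : (c:ℝ) < b
    swap
    · exact Eventually.of_forall fun x _ h => absurd h hcb
    by_cases hbβ : (((b:ℝ)) : EReal) < cfBeta α
    swap
    · exact Eventually.of_forall fun x _ _ h => absurd h hbβ
    have hloc : ∀ E0 : ℝ, L E0 < c → ∃ r : ℝ, 0 < r ∧ ∀ᵐ x ∂unu, ∀ E', |E' - E0| ≤ r →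
        ∃ᶠ q : ℕ in atTop,
        ‖schCocycle α f E' q (x + q * α) - schCocycle α f E' q x‖ ≤ 1 / 6 ∧
        ‖schCocycle α f E' q x - schCocycle α f E' q (x - q * α)‖ ≤ 1 / 6 := by
      intro E0 hE0
      obtain ⟨N, hN, hN1⟩ := (((hL E0).eventually (gt_mem_nhds hE0)).and
        (eventually_ge_atTop 1)).exists
      apply core hα hper hmono hi E0 c b hb0 hcb hbβ N hN1
      have hN' : (0:ℝ) < N := by exact_mod_cast hN1
      rw [one_div, inv_mul_lt_iff₀ hN'] at hN
      exact hN
    choose! r hr0 hr using hloc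
    obtain ⟨t, htS, htc, hcov⟩ := TopologicalSpace.countable_cover_nhdsWithin
      (s := {E : ℝ | L E < c}) (f := fun E => Metric.closedBall E (r E))
      (fun E hE => mem_nhdsWithin_of_mem_nhds (Metric.closedBall_mem_nhds E (hr0 E hE)))
    have hall : ∀ᵐ x ∂unu, ∀ E0 ∈ t, ∀ E', |E' - E0| ≤ r E0 →
        ∃ᶠ q : ℕ in atTop,
        ‖schCocycle α f E' q (x + q * α) - schCocycle α f E' q x‖ ≤ 1 / 6 ∧
        ‖schCocycle α f E' q x - schCocycle α f E' q (x - q * α)‖ ≤ 1 / 6 := by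
      rw [ae_ball_iff htc]
      intro E0 hE0
      exact hr E0 (htS hE0)
    filter_upwards [hall] with x hx _ _ _ E hE
    have := hcov hE
    simp only [Set.mem_iUnion] at this
    obtain ⟨E0, hE0, hd⟩ := this
    exact hx E0 hE0 E (by simpa [Real.dist_eq] using hd)
  have key2 : ∀ᵐ x ∂unu, ∀ c b : ℚ, 0 < (b:ℝ) → (c:ℝ) < b → (((b:ℝ)) : EReal) < cfBeta α →
      ∀ E : ℝ, L E < c → ∃ᶠ q : ℕ in atTop,
      ‖schCocycle α f E q (x + q * α) - schCocycle α f E q x‖ ≤ 1 / 6 ∧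
      ‖schCocycle α f E q x - schCocycle α f E q (x - q * α)‖ ≤ 1 / 6 := by
    rw [ae_all_iff]; intro c
    rw [ae_all_iff]; intro b
    exact key c b
  change ∀ᵐ x ∂unu, _
  filter_upwards [key2] with x hx E hE0 hEβ
  rintro ⟨ψ, hψ, hs, heq⟩
  obtain ⟨b, hb1, hb2⟩ := EReal.exists_rat_btwn_of_lt hEβ
  have hb1' : L E < (b:ℝ) := by exact_mod_cast hb1
  obtain ⟨c, hc1, hc2⟩ := exists_rat_btwn hb1'
  exact hψ (gordon α f E x ψ heq hs (hx c b (by linarith) hc2 (by exact_mod_cast hb2) E hc1))
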